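/- arXiv:1707.08807 — 8 statements merged into one kernel-verified Lean document; each statement's English description precedes it below -/
import Mathlib

section
/- For every natural number n ≥ 2 there exists an NCA-labeling scheme for the family of all rooted trees on at most n vertices whose label space has size less than n^{2.318} (equivalently, labels require fewer than 2.318·log₂ n bits): there is a natural number m < n^{2.318}, a decoder g : {0,…,m−1} × {0,…,m−1} → {0,…,m−1}, and for every rooted tree T on at most n vertices an injective encoder f_T : V(T) → {0,…,m−1} such that g(f_T(u), f_T(v)) = f_T(nca_T(u,v)) for all u, v ∈ V(T). -/
/-- `u` is an ancestor of `v` w.r.t. the parent function `p`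
(every vertex is an ancestor of itself, via `k = 0`). -/
def IsAncestorOf {V : Type*} (p : V → V) (u v : V) : Prop := ∃ k : ℕ, p^[k] v = u

/-- `w` is the nearest common ancestor of `u` and `v` w.r.t. the parent function `p`:
`w` is a common ancestor and every common ancestor of `u` and `v` is an ancestor of `w`
(i.e. `w` is the common ancestor furthest from the root). -/
def IsNcaOf {V : Type*} (p : V → V) (u v w : V) : Prop :=
  IsAncestorOf p w u ∧ IsAncestorOf p w v ∧
    ∀ x, IsAncestorOf p x u → IsAncestorOf p x v → IsAncestorOf p x w

/-- A finite rooted tree, encoded by a parent function on `Fin n`: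
the root is its own parent and every vertex reaches the root by iterating `parent`. -/
structure FinRootedTree where
  n : ℕ
  pos : 0 < n
  parent : Fin n → Fin n
  root : Fin n
  parent_root : parent root = root
  reaches_root : ∀ v, ∃ k : ℕ, parent^[k] v = root

namespace FinRootedTree

def IsAncestor (T : FinRootedTree) (u v : Fin T.n) : Prop := IsAncestorOf T.parent u v

def IsNCA (T : FinRootedTree) (u v w : Fin T.n) : Prop := IsNcaOf T.parent u v w

end FinRootedTree

/-- An NCA-preserving embedding of `T` into `S`: an injective map on the vertices
that commutes with the nearest-common-ancestor function. -/
def NcaEmbedding (T S : FinRootedTree) (φ : Fin T.n → Fin S.n) : Prop :=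
  Function.Injective φ ∧ ∀ u v w, T.IsNCA u v w → S.IsNCA (φ u) (φ v) (φ w)

namespace FinRootedTree

/-- A rooted tree is binary if every vertex has at most two children. -/
def IsBinary (T : FinRootedTree) : Prop :=
  ∀ v : Fin T.n, {u : Fin T.n | T.parent u = v ∧ u ≠ v}.ncard ≤ 2

/-- A leaf is a vertex with no children. -/
def IsLeaf (T : FinRootedTree) (w : Fin T.n) : Prop := ∀ u, T.parent u = w → u = w

end FinRootedTree

namespace NcaLabeling

/-- The partial map `f`, defined on `S`, is injective and turns meets into the operation `g`. -/
structure IsLabeling {V L : Type} [SemilatticeInf V] (S : Finset V) (g : L → L → L)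
    (f : ∀ u, u ∈ S → L) : Prop where
  inj : ∀ u hu v hv, f u hu = f v hv → u = v
  map_inf : ∀ u hu v hv (h : u ⊓ v ∈ S), g (f u hu) (f v hv) = f (u ⊓ v) h

/-- The order of ancestors of a rooted tree: the elements below a given one form a chain. -/
def IsTreeOrder (V : Type) [SemilatticeInf V] : Prop :=
  ∀ a b c : V, a ≤ c → b ≤ c → a ≤ b ∨ b ≤ a

/-- `g` decodes meets for all trees with at most `N` vertices. -/
def IsTreeScheme (N : ℕ) {L : Type} (g : L → L → L) : Prop :=
  ∀ (V : Type) [SemilatticeInf V], IsTreeOrder V → ∀ S : Finset V,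
    (∀ a ∈ S, ∀ b ∈ S, a ⊓ b ∈ S) → S.card ≤ N → ∃ f : ∀ u, u ∈ S → L, IsLabeling S g f

/-- `g` decodes meets, and `π` decodes meets with a vertex `p` (possibly outside the tree), for all
trees with at most `N` vertices. -/
def IsSpineScheme (N : ℕ) {L : Type} (g : L → L → L) (π : L → L) : Prop :=
  ∀ (V : Type) [SemilatticeInf V], IsTreeOrder V → ∀ (S : Finset V) (p : V),
    (∀ a ∈ S, ∀ b ∈ S, a ⊓ b ∈ S) → (∀ a ∈ S, a ⊓ p ∈ S) → S.card ≤ N →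
    ∃ f : ∀ u, u ∈ S → L, IsLabeling S g f ∧ ∀ u hu (h : u ⊓ p ∈ S), π (f u hu) = f (u ⊓ p) h

section Decoder

variable {J L₁ L₂ : Type} {L : J → Type}

/-- Labels for a tree split at a vertex: the part above it, the vertex itself, the forest hanging
from it, and the part below it along a distinguished path. -/
abbrev NodeLabel (L₁ : Type) (L : J → Type) (L₂ : Type) : Type :=
  L₁ ⊕ Unit ⊕ (Σ j, L j) ⊕ L₂

open Classical in
/-- The decoder on `NodeLabel`. -/
noncomputable def nodeDec (g₁ : L₁ → L₁ → L₁) (π₁ : L₁ → L₁) (g : ∀ j, L j → L j → L j)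
    (g₂ : L₂ → L₂ → L₂) : NodeLabel L₁ L L₂ → NodeLabel L₁ L L₂ → NodeLabel L₁ L L₂
  | .inl x, .inl y => .inl (g₁ x y)
  | .inl x, .inr _ => .inl (π₁ x)
  | .inr _, .inl y => .inl (π₁ y)
  | .inr (.inr (.inl x)), .inr (.inr (.inl y)) =>
    if h : x.1 = y.1 then .inr (.inr (.inl ⟨y.1, g y.1 (h ▸ x.2) y.2⟩)) else .inr (.inl ())
  | .inr (.inr (.inr x)), .inr (.inr (.inr y)) => .inr (.inr (.inr (g₂ x y)))
  | .inr _, .inr _ => .inr (.inl ())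

/-- The projection to the distinguished path on `NodeLabel`. -/
def nodeProj (π₁ : L₁ → L₁) (π₂ : L₂ → L₂) : NodeLabel L₁ L L₂ → NodeLabel L₁ L L₂
  | .inl x => .inl (π₁ x)
  | .inr (.inr (.inr x)) => .inr (.inr (.inr (π₂ x)))
  | .inr _ => .inr (.inl ())

end Decoder

section Order

variable {V : Type} [SemilatticeInf V]

lemma IsTreeOrder.inf_eq_of_not_le (hV : IsTreeOrder V) {u w v : V} (hu : ¬ v ≤ u) (hw : v ≤ w) :
    u ⊓ w = u ⊓ v := by
  apply le_antisymm
  · refine le_inf inf_le_left ?_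
    rcases hV (u ⊓ w) v w inf_le_right hw with h | h
    · exact h
    · exact absurd (h.trans inf_le_left) hu
  · exact inf_le_inf_left _ hw

lemma IsTreeOrder.lt_inf_of_le (hV : IsTreeOrder V) {v a b c : V} (ha : v < a) (hb : v < b)
    (hac : a ≤ c) (hbc : b ≤ c) : v < a ⊓ b := by
  rcases hV a b c hac hbc with h | h
  · rwa [inf_eq_left.2 h]
  · rwa [inf_eq_right.2 h]

lemma IsTreeOrder.lt_inf_trans (hV : IsTreeOrder V) {v a b c : V} (hab : v < a ⊓ b)
    (hbc : v < b ⊓ c) : v < a ⊓ c :=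
  (hV.lt_inf_of_le hab hbc inf_le_right inf_le_left).trans_le
    (inf_le_inf inf_le_left inf_le_right)

lemma exists_least_mem {S : Finset V} (hS : ∀ a ∈ S, ∀ b ∈ S, a ⊓ b ∈ S) (hne : S.Nonempty) :
    ∃ r ∈ S, ∀ u ∈ S, r ≤ u :=
  ⟨S.inf' hne id, Finset.inf'_mem (S : Set V) hS S hne id (fun _ h => h),
    fun _ hu => Finset.inf'_le id hu⟩

/-- Ranking a finite set by decreasing weight. -/
lemma exists_rank {ι : Type} [DecidableEq ι] (w : ι → ℕ) (I : Finset ι) :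
    ∃ e : ι → ℕ, Set.InjOn e I ∧ (∀ i ∈ I, e i < I.card) ∧
      ∀ i ∈ I, w i * (e i + 1) ≤ ∑ x ∈ I, w x := by
  induction I using Finset.induction_on_min_value w with
  | empty => exact ⟨fun _ => 0, by simp⟩
  | insert a s ha hmin ih =>
    obtain ⟨e, hinj, hlt, hw⟩ := ih
    have hne : ∀ x ∈ s, x ≠ a := fun x hx h => ha (h ▸ hx)
    refine ⟨Function.update e a s.card, ?_, ?_, ?_⟩
    · intro x hx y hy hxy
      simp only [Finset.coe_insert, Set.mem_insert_iff, Finset.mem_coe] at hx hy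
      rcases hx with rfl | hx <;> rcases hy with rfl | hy
      · rfl
      · have := hlt y hy
        simp [Function.update_of_ne (hne y hy)] at hxy
        omega
      · have := hlt x hx
        simp [Function.update_of_ne (hne x hx)] at hxy
        omega
      · rw [Function.update_of_ne (hne x hx), Function.update_of_ne (hne y hy)] at hxy
        exact hinj hx hy hxy
    · intro i hi
      rw [Finset.card_insert_of_notMem ha]
      rcases Finset.mem_insert.1 hi with rfl | hi
      · simp
      · rw [Function.update_of_ne (hne i hi)]
        exact (hlt i hi).trans (Nat.lt_succ_self _)
    · intro i hi
      rw [Finset.sum_insert ha]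
      rcases Finset.mem_insert.1 hi with rfl | hi
      · have := Finset.card_nsmul_le_sum s w (w i) hmin
        simp only [smul_eq_mul] at this
        rw [Function.update_self]
        linarith [mul_comm s.card (w i), mul_add (w i) s.card 1]
      · rw [Function.update_of_ne (hne i hi)]
        exact (hw i hi).trans (Nat.le_add_left _ _)

open Classical in
/-- The trees of the forest of strict descendants of `v` in `F` can be numbered by decreasing
size. -/
lemma exists_component (hV : IsTreeOrder V) (F : Finset V) (v : V) (hF : ∀ u ∈ F, v < u) {N : ℕ}
    (hN : F.card < N) :
    ∃ c : V → Fin N, (∀ a ∈ F, ∀ b ∈ F, c a = c b ↔ v < a ⊓ b) ∧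
      ∀ j : Fin N, (F.filter (c · = j)).card ≤ (N - 1) / (j + 1) := by
  set cls : V → Finset V := fun u => F.filter (fun x => v < u ⊓ x) with hcls
  have hcls_eq : ∀ a ∈ F, ∀ b ∈ F, cls a = cls b ↔ v < a ⊓ b := by
    intro a ha b hb
    constructor
    · intro h
      have : b ∈ cls a := by
        rw [h]
        simp [hcls, hb, hF b hb]
      exact (Finset.mem_filter.1 this).2
    · intro h
      ext x
      simp only [hcls, Finset.mem_filter]
      refine and_congr_right fun _ => ⟨fun hx => hV.lt_inf_trans (inf_comm a b ▸ h) hx,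
        fun hx => hV.lt_inf_trans h hx⟩
  have hfib : ∀ a ∈ F, F.filter (fun x => cls x = cls a) = cls a := by
    intro a ha
    ext x
    simp only [Finset.mem_filter]
    constructor
    · rintro ⟨hx, h⟩
      exact Finset.mem_filter.2 ⟨hx, (hcls_eq a ha x hx).1 h.symm⟩
    · intro h
      have := Finset.mem_filter.1 h
      exact ⟨this.1, ((hcls_eq a ha x this.1).2 this.2).symm⟩
  obtain ⟨e, hinj, -, hw⟩ := exists_rank Finset.card (F.image cls)
  have hsum : ∑ x ∈ F.image cls, x.card = F.card := by
    rw [Finset.card_eq_sum_card_image cls F]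
    refine Finset.sum_congr rfl fun x hx => ?_
    obtain ⟨a, ha, rfl⟩ := Finset.mem_image.1 hx
    rw [hfib a ha]
  have hbound : ∀ a ∈ F, (cls a).card * (e (cls a) + 1) ≤ F.card := fun a ha =>
    hsum ▸ hw _ (Finset.mem_image_of_mem _ ha)
  have hlt : ∀ a ∈ F, e (cls a) < N := by
    intro a ha
    have h1 : 0 < (cls a).card := Finset.card_pos.2 ⟨a, by simp [hcls, ha, hF a ha]⟩
    have h2 := hbound a ha
    nlinarith
  have hpos : 0 < N := by omega
  refine ⟨fun u => if h : e (cls u) < N then ⟨e (cls u), h⟩ else ⟨0, hpos⟩, ?_, ?_⟩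
  · intro a ha b hb
    simp only [hlt a ha, hlt b hb, dif_pos, Fin.mk.injEq]
    rw [← hcls_eq a ha b hb]
    exact ⟨fun h => hinj (Finset.mem_coe.2 (Finset.mem_image_of_mem _ ha))
      (Finset.mem_coe.2 (Finset.mem_image_of_mem _ hb)) h, fun h => by rw [h]⟩
  · intro j
    rcases Finset.eq_empty_or_nonempty (F.filter (fun u =>
      (if h : e (cls u) < N then (⟨e (cls u), h⟩ : Fin N) else ⟨0, hpos⟩) = j)) with h0 | ⟨a, haF⟩
    · rw [h0]
      simp
    · obtain ⟨ha, haj⟩ := Finset.mem_filter.1 haF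
      rw [dif_pos (hlt a ha)] at haj
      subst haj
      rw [Nat.le_div_iff_mul_le (Nat.succ_pos _)]
      have hb := hbound a ha
      refine (Nat.mul_le_mul_right _ (Finset.card_le_card ?_)).trans (hb.trans (by omega))
      intro x hx
      obtain ⟨hx, hxa⟩ := Finset.mem_filter.1 hx
      simp only [dif_pos (hlt x hx), Fin.mk.injEq] at hxa
      rw [← hfib a ha]
      exact Finset.mem_filter.2 ⟨hx, hinj (Finset.mem_coe.2 (Finset.mem_image_of_mem _ hx))
        (Finset.mem_coe.2 (Finset.mem_image_of_mem _ ha)) hxa⟩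

end Order

open Classical in
/-- Labelings of the parts of a tree split at the vertex `v` of the path leading to `p` combine to a
labeling of the whole tree. -/
lemma exists_nodeLabeling {V : Type} [SemilatticeInf V] (hV : IsTreeOrder V) {S : Finset V}
    (hS : ∀ a ∈ S, ∀ b ∈ S, a ⊓ b ∈ S) {p v : V} (hp : ∀ a ∈ S, a ⊓ p ∈ S) (hv : v ∈ S)
    (hvp : v ≤ p) {J L₁ L₂ : Type} [DecidableEq J] {L : J → Type} {N₁ N₂ : ℕ} {N : J → ℕ}
    {g₁ : L₁ → L₁ → L₁} {π₁ : L₁ → L₁} {g : ∀ j, L j → L j → L j} {g₂ : L₂ → L₂ → L₂}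
    {π₂ : L₂ → L₂} (h₁ : IsSpineScheme N₁ g₁ π₁) (h : ∀ j, IsTreeScheme (N j) (g j))
    (h₂ : IsSpineScheme N₂ g₂ π₂) (c : V → J)
    (hc : ∀ a ∈ S.filter (fun u => v < u ∧ ¬ v < u ⊓ p),
      ∀ b ∈ S.filter (fun u => v < u ∧ ¬ v < u ⊓ p), c a = c b ↔ v < a ⊓ b)
    (hN₁ : (S.filter (fun u => ¬ v ≤ u)).card ≤ N₁)
    (hN : ∀ j, ((S.filter (fun u => v < u ∧ ¬ v < u ⊓ p)).filter (c · = j)).card ≤ N j)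
    (hN₂ : (S.filter (fun u => v < u ⊓ p)).card ≤ N₂) :
    ∃ f : ∀ u, u ∈ S → NodeLabel L₁ L L₂, IsLabeling S (nodeDec g₁ π₁ g g₂) f ∧
      ∀ u hu (h : u ⊓ p ∈ S), nodeProj π₁ π₂ (f u hu) = f (u ⊓ p) h := by
  obtain ⟨f₁, hf₁, hπ₁⟩ := h₁ V hV (S.filter (fun u => ¬ v ≤ u)) v
    (by
      intro a ha b hb
      simp only [Finset.mem_filter] at ha hb ⊢
      exact ⟨hS _ ha.1 _ hb.1, fun h => ha.2 (h.trans inf_le_left)⟩)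
    (by
      intro a ha
      simp only [Finset.mem_filter] at ha ⊢
      exact ⟨hS _ ha.1 _ hv, fun h => ha.2 (h.trans inf_le_left)⟩) hN₁
  obtain ⟨f₂, hf₂, hπ₂⟩ := h₂ V hV (S.filter (fun u => v < u ⊓ p)) p
    (by
      intro a ha b hb
      simp only [Finset.mem_filter] at ha hb ⊢
      refine ⟨hS _ ha.1 _ hb.1, ?_⟩
      rw [inf_inf_distrib_right]
      exact hV.lt_inf_of_le ha.2 hb.2 inf_le_right inf_le_right)
    (by
      intro a ha
      simp only [Finset.mem_filter] at ha ⊢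
      exact ⟨hp _ ha.1, by simpa [inf_assoc] using ha.2⟩) hN₂
  have hfor := fun j => h j V hV
    ((S.filter (fun u => v < u ∧ ¬ v < u ⊓ p)).filter (c · = j))
    (by
      intro a ha' b hb'
      obtain ⟨ha, rfl⟩ := Finset.mem_filter.1 ha'
      obtain ⟨hb, hba⟩ := Finset.mem_filter.1 hb'
      have hab : v < a ⊓ b := (hc a ha b hb).1 hba.symm
      obtain ⟨haS, hva, hap⟩ := Finset.mem_filter.1 ha
      have hmem : a ⊓ b ∈ S.filter (fun u => v < u ∧ ¬ v < u ⊓ p) :=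
        Finset.mem_filter.2 ⟨hS _ haS _ (Finset.mem_filter.1 hb).1, hab,
          fun h => hap (h.trans_le (inf_le_inf_right _ inf_le_left))⟩
      refine Finset.mem_filter.2 ⟨hmem, (hc _ hmem _ ha).2 ?_⟩
      rwa [inf_right_comm, inf_idem]) (hN j)
  choose fF hfF using hfor
  have hne : ∀ u, v ≤ u → u ≠ v → v < u := fun u h1 h2 => lt_of_le_of_ne h1 (Ne.symm h2)
  let f : ∀ u, u ∈ S → NodeLabel L₁ L L₂ := fun u hu =>
    if h1 : v ≤ u then
      if h2 : u = v then .inr (.inl ())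
      else if h3 : v < u ⊓ p then .inr (.inr (.inr (f₂ u (Finset.mem_filter.2 ⟨hu, h3⟩))))
      else .inr (.inr (.inl ⟨c u, fF (c u) u (Finset.mem_filter.2
        ⟨Finset.mem_filter.2 ⟨hu, hne u h1 h2, h3⟩, rfl⟩)⟩))
    else .inl (f₁ u (Finset.mem_filter.2 ⟨hu, h1⟩))
  have ftop : ∀ u hu (h : ¬ v ≤ u), f u hu = .inl (f₁ u (Finset.mem_filter.2 ⟨hu, h⟩)) :=
    fun u hu h => dif_neg h
  have fmid : ∀ u hu, u = v → f u hu = .inr (.inl ()) := fun u hu h => by simp [f, h]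
  have fbot : ∀ u hu (h : v < u ⊓ p),
      f u hu = .inr (.inr (.inr (f₂ u (Finset.mem_filter.2 ⟨hu, h⟩)))) := by
    intro u hu h
    have h' : v < u := h.trans_le inf_le_left
    simp only [f, dif_pos h'.le, dif_neg h'.ne', dif_pos h]
  have ffor : ∀ u hu j (h : u ∈ (S.filter (fun u => v < u ∧ ¬ v < u ⊓ p)).filter (c · = j)),
      f u hu = .inr (.inr (.inl ⟨j, fF j u h⟩)) := by
    intro u hu j h
    obtain ⟨h', rfl⟩ := Finset.mem_filter.1 h
    obtain ⟨-, h1, h2⟩ := Finset.mem_filter.1 h'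
    simp only [f, dif_pos h1.le, dif_neg h1.ne', dif_neg h2]
  clear_value f
  have hcases : ∀ u hu, (¬ v ≤ u ∧ ∃ h, f u hu = .inl (f₁ u h)) ∨
      (u = v ∧ f u hu = .inr (.inl ())) ∨
      ((v < u ∧ ¬ v < u ⊓ p) ∧ ∃ j h, f u hu = .inr (.inr (.inl ⟨j, fF j u h⟩))) ∨
      (v < u ⊓ p ∧ ∃ h, f u hu = .inr (.inr (.inr (f₂ u h)))) := by
    intro u hu
    by_cases h1 : v ≤ u
    · by_cases h2 : u = v
      · exact .inr (.inl ⟨h2, fmid u hu h2⟩)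
      · by_cases h3 : v < u ⊓ p
        · exact .inr (.inr (.inr ⟨h3, _, fbot u hu h3⟩))
        · exact .inr (.inr (.inl ⟨⟨hne u h1 h2, h3⟩, _, _, ffor u hu (c u)
            (by simp [hu, hne u h1 h2, h3])⟩))
    · exact .inl ⟨h1, _, ftop u hu h1⟩
  have eqv : ∀ {w}, v ≤ w → ¬ v < w → w = v := fun h1 h2 => (h1.eq_or_lt.resolve_right h2).symm
  have topInf : ∀ {u w} (hu : u ∈ S) (h : ¬ v ≤ u) (hw : v ≤ w) (huw : u ⊓ w ∈ S) h',
      f (u ⊓ w) huw = .inl (π₁ (f₁ u h')) := by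
    intro u w hu h hw huw h'
    have e := hV.inf_eq_of_not_le h hw
    have hle : ¬ v ≤ u ⊓ v := fun hh => h (hh.trans inf_le_left)
    rw [hπ₁ u h' (Finset.mem_filter.2 ⟨hS _ hu _ hv, hle⟩)]
    simp only [e]
    exact ftop _ _ hle
  have hsplit : ∀ {u w}, v < u → ¬ v < u ⊓ p → v < w ⊓ p → ¬ v < u ⊓ w := by
    intro u w _ h2 h3 h4
    exact h2 (hV.lt_inf_trans h4 h3)
  refine ⟨f, ⟨?_, ?_⟩, ?_⟩
  · intro u hu w hw he
    rcases hcases u hu with ⟨-, h1, e1⟩ | ⟨h1, e1⟩ | ⟨-, j, h1, e1⟩ | ⟨-, h1, e1⟩ <;>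
    rcases hcases w hw with ⟨-, h2, e2⟩ | ⟨h2, e2⟩ | ⟨-, i, h2, e2⟩ | ⟨-, h2, e2⟩ <;>
    rw [e1, e2] at he <;> simp at he
    · exact hf₁.inj _ _ _ _ he
    · exact h1.trans h2.symm
    · obtain ⟨rfl, he⟩ := he
      exact (hfF j).inj _ _ _ _ (eq_of_heq he)
    · exact hf₂.inj _ _ _ _ he
  · intro u hu w hw huw
    rcases hcases u hu with ⟨k1, h1, e1⟩ | ⟨k1, e1⟩ | ⟨⟨k1, k1'⟩, j, h1, e1⟩ | ⟨k1, h1, e1⟩ <;>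
    rcases hcases w hw with ⟨k2, h2, e2⟩ | ⟨k2, e2⟩ | ⟨⟨k2, k2'⟩, i, h2, e2⟩ | ⟨k2, h2, e2⟩ <;>
    rw [e1, e2] <;> simp only [nodeDec]
    · have hle : ¬ v ≤ u ⊓ w := fun hh => k1 (hh.trans inf_le_left)
      rw [ftop _ huw hle, hf₁.map_inf]
    · exact (topInf hu k1 k2.ge huw _).symm
    · exact (topInf hu k1 k2.le huw _).symm
    · exact (topInf hu k1 (k2.trans_le inf_le_left).le huw _).symm
    · simp only [inf_comm u w] at huw ⊢
      exact (topInf hw k2 k1.ge huw _).symm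
    · exact (fmid _ _ (by rw [k1, k2, inf_idem])).symm
    · exact (fmid _ _ (by rw [k1, inf_eq_left.2 k2.le])).symm
    · exact (fmid _ _ (by rw [k1, inf_eq_left.2 (k2.trans_le inf_le_left).le])).symm
    · simp only [inf_comm u w] at huw ⊢
      exact (topInf hw k2 k1.le huw _).symm
    · exact (fmid _ _ (by rw [k2, inf_eq_right.2 k1.le])).symm
    · obtain ⟨h1', hj⟩ := Finset.mem_filter.1 h1
      obtain ⟨h2', hi⟩ := Finset.mem_filter.1 h2
      by_cases hji : j = i
      · subst hji
        have hlt : v < u ⊓ w := (hc u h1' w h2').1 (hj.trans hi.symm)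
        have hmem : u ⊓ w ∈ S.filter (fun u => v < u ∧ ¬ v < u ⊓ p) :=
          Finset.mem_filter.2 ⟨huw, hlt, fun h => k1' (h.trans_le (inf_le_inf_right _ inf_le_left))⟩
        have hcj : c (u ⊓ w) = j := by
          rw [← hj]
          refine (hc _ hmem _ h1').2 ?_
          rwa [inf_right_comm, inf_idem]
        rw [dif_pos rfl, ffor _ huw j (Finset.mem_filter.2 ⟨hmem, hcj⟩), (hfF j).map_inf]
      · rw [dif_neg hji]
        refine (fmid _ _ (eqv (le_inf k1.le k2.le) fun h => hji ?_)).symm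
        rw [← hj, ← hi]
        exact (hc u h1' w h2').2 h
    · exact (fmid _ _ (eqv (le_inf k1.le (k2.trans_le inf_le_left).le)
        (hsplit k1 k1' k2))).symm
    · simp only [inf_comm u w] at huw ⊢
      exact (topInf hw k2 (k1.trans_le inf_le_left).le huw _).symm
    · exact (fmid _ _ (by rw [k2, inf_eq_right.2 (k1.trans_le inf_le_left).le])).symm
    · simp only [inf_comm u w] at huw ⊢
      exact (fmid _ _ (eqv (le_inf k2.le (k1.trans_le inf_le_left).le)
        (hsplit k2 k2' k1))).symm
    · have hlt : v < (u ⊓ w) ⊓ p := by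
        rw [inf_inf_distrib_right]
        exact hV.lt_inf_of_le k1 k2 inf_le_right inf_le_right
      rw [fbot _ huw hlt, hf₂.map_inf]
  · intro u hu hup
    rcases hcases u hu with ⟨k1, h1, e1⟩ | ⟨k1, e1⟩ | ⟨⟨k1, k1'⟩, j, h1, e1⟩ | ⟨k1, h1, e1⟩ <;>
    rw [e1] <;> simp only [nodeProj]
    · exact (topInf hu k1 hvp hup _).symm
    · exact (fmid _ _ (by rw [k1, inf_eq_left.2 hvp])).symm
    · exact (fmid _ _ (eqv (le_inf k1.le hvp) k1')).symm
    · have hlt : v < (u ⊓ p) ⊓ p := by rwa [inf_assoc, inf_idem]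
      rw [fbot _ hup hlt, hπ₂]

lemma card_filter_not_add {V : Type} (S : Finset V) (q : V → Prop) [DecidablePred q] :
    (S.filter (fun u => ¬ q u)).card + (S.filter q).card = S.card := by
  rw [add_comm]
  exact Finset.card_filter_add_card_filter_not q

/-- A spine scheme for `N` vertices obtained by splitting at the middle vertex of the path, with the
trees hanging from that vertex ranked by size. -/
theorem IsSpineScheme.node {N : ℕ} {L₁ L₂ : Type} {L : Fin N → Type}
    {g₁ : L₁ → L₁ → L₁} {π₁ : L₁ → L₁} {g : ∀ j, L j → L j → L j} {g₂ : L₂ → L₂ → L₂}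
    {π₂ : L₂ → L₂} (h₁ : IsSpineScheme (N / 2) g₁ π₁)
    (h : ∀ j : Fin N, IsTreeScheme ((N - 1) / (j + 1)) (g j))
    (h₂ : IsSpineScheme (N / 2) g₂ π₂) :
    IsSpineScheme N (nodeDec g₁ π₁ g g₂) (nodeProj π₁ π₂) := by
  classical
  intro V _ hV S p hS hp hcard
  rcases S.eq_empty_or_nonempty with rfl | hne
  · exact ⟨fun u hu => absurd hu (Finset.notMem_empty u), ⟨by simp, by simp⟩, by simp⟩
  obtain ⟨r, hr, hrle⟩ := exists_least_mem hS hne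
  obtain ⟨v, hv, hvmax⟩ := (S.filter (fun v => v ≤ p ∧ S.card ≤ 2 *
    (S.filter (fun u => v ≤ u)).card)).exists_maximal ⟨r, by
      rw [Finset.mem_filter]
      refine ⟨hr, (hrle _ (hp r hr)).trans inf_le_right, ?_⟩
      rw [Finset.filter_true_of_mem hrle]
      omega⟩
  obtain ⟨hvS, hvp, hvcard⟩ := Finset.mem_filter.1 hv
  have hsub : (S.filter (fun u => v < u ∧ ¬ v < u ⊓ p)).card < N := by
    refine (Finset.card_lt_card (Finset.filter_ssubset.2 ⟨v, hvS, by simp⟩)).trans_le hcard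
  obtain ⟨c, hc, hcN⟩ := exists_component hV _ v
    (fun u hu => (Finset.mem_filter.1 hu).2.1) hsub
  refine exists_nodeLabeling hV hS hp hvS hvp h₁ h h₂ c hc ?_ hcN ?_
  · have := card_filter_not_add S (fun u => v ≤ u)
    omega
  · rcases (S.filter (fun u => v < u ⊓ p)).eq_empty_or_nonempty with h0 | hne'
    · simp [h0]
    obtain ⟨w, hw, hwle⟩ := exists_least_mem (S := S.filter (fun u => v < u ⊓ p)) (by
      intro a ha b hb
      simp only [Finset.mem_filter] at ha hb ⊢
      refine ⟨hS _ ha.1 _ hb.1, ?_⟩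
      rw [inf_inf_distrib_right]
      exact hV.lt_inf_of_le ha.2 hb.2 inf_le_right inf_le_right) hne'
    obtain ⟨hwS, hvw⟩ := Finset.mem_filter.1 hw
    have hwp : w ≤ p := (hwle (w ⊓ p) (Finset.mem_filter.2
      ⟨hp w hwS, by rwa [inf_assoc, inf_idem]⟩)).trans inf_le_right
    have hlt : v < w := hvw.trans_le inf_le_left
    have hle : (S.filter (fun u => v < u ⊓ p)).card ≤ (S.filter (fun u => w ≤ u)).card :=
      Finset.card_le_card fun x hx => Finset.mem_filter.2 ⟨(Finset.mem_filter.1 hx).1, hwle x hx⟩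
    by_contra hcon
    exact hlt.not_ge (hvmax (Finset.mem_filter.2 ⟨hwS, hwp, by omega⟩) hlt.le)

/-- A tree scheme for `N` vertices obtained by splitting at the deepest vertex having at least two
thirds of the vertices below it, with the trees hanging from that vertex ranked by size. -/
theorem IsTreeScheme.node {N : ℕ} {L₁ : Type} {L : Fin N → Type}
    {g₁ : L₁ → L₁ → L₁} {π₁ : L₁ → L₁} {g : ∀ j, L j → L j → L j}
    (h₁ : IsSpineScheme (N / 3) g₁ π₁)
    (h : ∀ j : Fin N, IsTreeScheme (if (j : ℕ) = 0 then 2 * N / 3 else (N - 1) / (j + 1)) (g j)) :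
    IsTreeScheme N (nodeDec g₁ π₁ g (fun x _ : Empty => x)) := by
  classical
  intro V _ hV S hS hcard
  rcases S.eq_empty_or_nonempty with rfl | hne
  · exact ⟨fun u hu => absurd hu (Finset.notMem_empty u), ⟨by simp, by simp⟩⟩
  obtain ⟨r, hr, hrle⟩ := exists_least_mem hS hne
  obtain ⟨v, hv, hvmax⟩ := (S.filter (fun v => 2 * S.card ≤ 3 *
    (S.filter (fun u => v ≤ u)).card)).exists_maximal ⟨r, by
      rw [Finset.mem_filter]
      refine ⟨hr, ?_⟩
      rw [Finset.filter_true_of_mem hrle]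
      omega⟩
  obtain ⟨hvS, hvcard⟩ := Finset.mem_filter.1 hv
  have hsub : (S.filter (fun u => v < u ∧ ¬ v < u ⊓ v)).card < N := by
    refine (Finset.card_lt_card (Finset.filter_ssubset.2 ⟨v, hvS, by simp⟩)).trans_le hcard
  obtain ⟨c, hc, hcN⟩ := exists_component hV _ v
    (fun u hu => (Finset.mem_filter.1 hu).2.1) hsub
  have h₂ : IsSpineScheme 0 (fun x _ : Empty => x) id := by
    intro V _ hV S p hS hp hcard
    obtain rfl := Finset.card_eq_zero.1 (Nat.le_zero.1 hcard)
    exact ⟨fun u hu => absurd hu (Finset.notMem_empty u), ⟨by simp, by simp⟩, by simp⟩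
  obtain ⟨f, hf, -⟩ := exists_nodeLabeling hV hS (p := v) (fun a ha => hS a ha v hvS) hvS le_rfl
    h₁ h h₂ c hc (by
      have := card_filter_not_add S (fun u => v ≤ u)
      omega) (by
      intro j
      split_ifs with hj
      · set C := (S.filter (fun u => v < u ∧ ¬ v < u ⊓ v)).filter (c · = j) with hC
        rcases C.eq_empty_or_nonempty with h0 | hne'
        · simp [h0]
        have hmem : ∀ {x}, x ∈ C ↔ x ∈ S.filter (fun u => v < u ∧ ¬ v < u ⊓ v) ∧ c x = j :=
          Finset.mem_filter
        obtain ⟨w, hw, hwle⟩ := exists_least_mem (S := C) (by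
          intro a ha b hb
          rw [hmem] at ha hb
          have hab : v < a ⊓ b := (hc a ha.1 b hb.1).1 (ha.2.trans hb.2.symm)
          have hF : a ⊓ b ∈ S.filter (fun u => v < u ∧ ¬ v < u ⊓ v) :=
            Finset.mem_filter.2 ⟨hS _ (Finset.mem_filter.1 ha.1).1 _ (Finset.mem_filter.1 hb.1).1,
              hab, fun h => h.not_ge inf_le_right⟩
          refine hmem.2 ⟨hF, ?_⟩
          rw [← ha.2]
          refine (hc _ hF _ ha.1).2 ?_
          rwa [inf_right_comm, inf_idem]) hne'
        obtain ⟨hwS, hlt, -⟩ := Finset.mem_filter.1 (hmem.1 hw).1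
        have hle : C.card ≤ (S.filter (fun u => w ≤ u)).card :=
          Finset.card_le_card fun x hx => Finset.mem_filter.2
            ⟨(Finset.mem_filter.1 (hmem.1 hx).1).1, hwle x hx⟩
        by_contra hcon
        exact hlt.not_ge (hvmax (Finset.mem_filter.2 ⟨hwS, by omega⟩) hlt.le)
      · exact hcN j) (by
      rw [Finset.filter_false_of_mem (fun u _ h => h.not_ge inf_le_right)]
      simp)
  exact ⟨f, hf⟩

section Numerics

/-- Bernoulli's inequality for negative exponents. -/
lemma one_sub_mul_le_rpow_neg {s b : ℝ} (hs : -1 < s) (hb : 1 ≤ b) :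
    1 - b * s ≤ (1 + s) ^ (-b) := by
  have hs' : 0 < 1 + s := by linarith
  have h := one_add_mul_self_le_rpow_one_add
    (by linarith [inv_pos.2 hs'] : -1 ≤ (1 + s)⁻¹ - 1) hb
  rw [add_sub_cancel, Real.inv_rpow hs'.le, ← Real.rpow_neg hs'.le] at h
  have h1 : (1 + s)⁻¹ - 1 + s = s ^ 2 / (1 + s) := by
    field_simp
    ring
  have h2 : 0 ≤ s ^ 2 / (1 + s) := by positivity
  nlinarith

/-- Tangent-line bound for the tail of the zeta series. -/
lemma rpow_neg_le_sub {a x : ℝ} (ha : 0 < a) (hx : 1 ≤ x) :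
    x ^ (-(a + 1)) ≤ ((x - 1 / 2) ^ (-a) - (x + 1 / 2) ^ (-a)) / a := by
  have hx0 : 0 < x := by linarith
  have hder : ∀ u ∈ Set.Icc (0 : ℝ) (1 / 2), HasDerivAt
      (fun u : ℝ => (x - u) ^ (-a) - (x + u) ^ (-a) - 2 * a * u * x ^ (-(a + 1)))
      (a * ((x - u) ^ (-a - 1) + (x + u) ^ (-a - 1)) - 2 * a * x ^ (-(a + 1))) u := by
    intro u hu
    have h1 : HasDerivAt (fun u : ℝ => (x - u) ^ (-a)) (-1 * (-a) * (x - u) ^ (-a - 1)) u :=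
      ((hasDerivAt_id u).const_sub x).rpow_const (.inl (by simp only [id]; linarith [hu.2]))
    have h2 : HasDerivAt (fun u : ℝ => (x + u) ^ (-a)) (1 * (-a) * (x + u) ^ (-a - 1)) u :=
      ((hasDerivAt_id u).const_add x).rpow_const (.inl (by simp only [id]; linarith [hu.1]))
    have h3 : HasDerivAt (fun u : ℝ => 2 * a * u * x ^ (-(a + 1)))
        (2 * a * 1 * x ^ (-(a + 1))) u :=
      ((hasDerivAt_id u).const_mul (2 * a)).mul_const _
    refine ((h1.sub h2).sub h3).congr_deriv ?_
    ring
  have hbern : ∀ u : ℝ, |u| ≤ 1 / 2 →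
      x ^ (-(a + 1)) * (1 - (a + 1) * (u / x)) ≤ (x + u) ^ (-(a + 1)) := by
    intro u hu
    obtain ⟨hu1, hu2⟩ := abs_le.1 hu
    have hux : -1 < u / x := by
      rw [lt_div_iff₀ hx0]
      linarith
    have := one_sub_mul_le_rpow_neg hux (by linarith : 1 ≤ a + 1)
    rw [show x + u = x * (1 + u / x) by field_simp, Real.mul_rpow hx0.le (by linarith)]
    gcongr
  have hmono : MonotoneOn
      (fun u : ℝ => (x - u) ^ (-a) - (x + u) ^ (-a) - 2 * a * u * x ^ (-(a + 1)))
      (Set.Icc 0 (1 / 2)) := by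
    apply monotoneOn_of_hasDerivWithinAt_nonneg (convex_Icc _ _)
      (fun u hu => (hder u hu).continuousAt.continuousWithinAt)
      (fun u hu => (hder u (interior_subset hu)).hasDerivWithinAt)
    intro u hu
    obtain ⟨h0, h1⟩ := interior_subset hu
    have e1 := hbern u (abs_le.2 ⟨by linarith, h1⟩)
    have e2 := hbern (-u) (abs_le.2 ⟨by linarith, by linarith⟩)
    rw [← sub_eq_add_neg] at e2
    rw [show -a - 1 = -(a + 1) by ring]
    have : 2 * x ^ (-(a + 1)) ≤ (x - u) ^ (-(a + 1)) + (x + u) ^ (-(a + 1)) := by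
      rw [neg_div] at e2
      linarith
    nlinarith
  have := hmono (Set.left_mem_Icc.2 (by norm_num)) (Set.right_mem_Icc.2 (by norm_num))
    (by norm_num : (0 : ℝ) ≤ 1 / 2)
  simp only [sub_zero, add_zero, sub_self, mul_zero, zero_mul] at this
  rw [le_div_iff₀ ha]
  linarith

lemma rpow_neg_le_of_pow_le {x r : ℝ} (hx : 0 < x) (hr : 0 ≤ r) (k : ℕ)
    (h : 1 ≤ r ^ 500 * x ^ k) : x ^ (-((k : ℝ) / 500)) ≤ r := by
  have h' : (x ^ k)⁻¹ ≤ r ^ 500 := (inv_le_iff_one_le_mul₀ (by positivity)).2 h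
  have := Real.rpow_le_rpow (by positivity) h' (z := 1 / 500) (by norm_num)
  rw [Real.inv_rpow (by positivity)] at this
  rwa [← Real.rpow_natCast x, ← Real.rpow_mul hx.le, ← Real.rpow_natCast r, ← Real.rpow_mul hr,
    show ((500 : ℕ) : ℝ) * (1 / 500) = 1 by norm_num, Real.rpow_one, mul_one_div,
    ← Real.rpow_neg hx.le] at this

set_option exponentiation.threshold 2000

lemma two_rpow_le : (2 : ℝ) ^ (-2.318 : ℝ) ≤ 0.2005454 := by
  have := rpow_neg_le_of_pow_le (x := 2) (r := 0.2005454) (by norm_num) (by norm_num) 1159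
    (by norm_num)
  norm_num at this ⊢
  exact this

lemma three_rpow_le : (3 : ℝ) ^ (-2.318 : ℝ) ≤ 0.0783491 := by
  have := rpow_neg_le_of_pow_le (x := 3) (r := 0.0783491) (by norm_num) (by norm_num) 1159
    (by norm_num)
  norm_num at this ⊢
  exact this

lemma two_thirds_rpow_le : (2 / 3 : ℝ) ^ (2.318 : ℝ) ≤ 0.3906794 := by
  have := rpow_neg_le_of_pow_le (x := 3 / 2) (r := 0.3906794) (by norm_num) (by norm_num) 1159
    (by norm_num)
  rw [Real.rpow_neg (by norm_num), ← Real.inv_rpow (by norm_num)] at this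
  norm_num at this ⊢
  exact this

/-- An upper bound for the value of the zeta function at `2.318`. -/
lemma sum_rpow_le (M : ℕ) :
    ∑ j ∈ Finset.range M, ((j : ℝ) + 1) ^ (-2.318 : ℝ) ≤ 1.4230574 := by
  have htail : ∀ M : ℕ, ∑ j ∈ Finset.range M, ((j : ℝ) + 9) ^ (-2.318 : ℝ) ≤
      ((17 / 2 : ℝ) ^ (-1.318 : ℝ) - ((M : ℝ) + 17 / 2) ^ (-1.318 : ℝ)) / 1.318 := by
    intro M
    induction M with
    | zero => simp
    | succ M ih =>
      rw [Finset.sum_range_succ]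
      have := rpow_neg_le_sub (a := 1.318) (x := (M : ℝ) + 9) (by norm_num)
        (by linarith [(Nat.cast_nonneg M : (0 : ℝ) ≤ M)])
      rw [show (M : ℝ) + 9 - 1 / 2 = M + 17 / 2 by ring,
        show (M : ℝ) + 9 + 1 / 2 = (M + 1 : ℕ) + 17 / 2 by push_cast; ring,
        show (-(1.318 + 1) : ℝ) = -2.318 by norm_num] at this
      rw [sub_div] at *
      linarith
  have hpow : ∀ (x r : ℝ), 0 < x → 0 ≤ r → 1 ≤ r ^ 500 * x ^ 1159 → x ^ (-2.318 : ℝ) ≤ r := by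
    intro x r hx hr h
    have := rpow_neg_le_of_pow_le hx hr 1159 h
    rwa [show (-((1159 : ℕ) / 500 : ℝ)) = -2.318 by norm_num] at this
  have h17 : (17 / 2 : ℝ) ^ (-1.318 : ℝ) ≤ 0.0595698 := by
    have := rpow_neg_le_of_pow_le (x := 17 / 2) (r := 0.0595698) (by norm_num) (by norm_num) 659
      (by norm_num)
    rwa [show (-((659 : ℕ) / 500 : ℝ)) = -1.318 by norm_num] at this
  calc ∑ j ∈ Finset.range M, ((j : ℝ) + 1) ^ (-2.318 : ℝ)
      ≤ ∑ j ∈ Finset.range (8 + M), ((j : ℝ) + 1) ^ (-2.318 : ℝ) :=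
        Finset.sum_le_sum_of_subset_of_nonneg (Finset.range_mono (by omega))
          (fun _ _ _ => by positivity)
    _ ≤ 1.4230574 := by
      rw [Finset.sum_range_add]
      have h0 : ∑ j ∈ Finset.range M, (((8 + j : ℕ) : ℝ) + 1) ^ (-2.318 : ℝ) =
          ∑ j ∈ Finset.range M, ((j : ℝ) + 9) ^ (-2.318 : ℝ) :=
        Finset.sum_congr rfl fun j _ => by
          congr 1
          push_cast
          ring
      have hM : 0 ≤ ((M : ℝ) + 17 / 2) ^ (-1.318 : ℝ) := by positivity
      have ht : ∑ j ∈ Finset.range M, ((j : ℝ) + 9) ^ (-2.318 : ℝ) ≤ 0.0451972 := by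
        refine (htail M).trans ?_
        rw [div_le_iff₀ (by norm_num)]
        linarith
      rw [h0]
      have h4 := hpow 4 0.0402186 (by norm_num) (by norm_num) (by norm_num)
      have h5 := hpow 5 0.0239767 (by norm_num) (by norm_num) (by norm_num)
      have h6 := hpow 6 0.0157127 (by norm_num) (by norm_num) (by norm_num)
      have h7 := hpow 7 0.0109918 (by norm_num) (by norm_num) (by norm_num)
      have h8 := hpow 8 0.0080658 (by norm_num) (by norm_num) (by norm_num)
      have h2 := two_rpow_le
      have h3 := three_rpow_le
      simp only [Finset.sum_range_succ, Finset.sum_range_zero, Nat.cast_zero, Nat.cast_ofNat,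
        Nat.cast_one, zero_add, Real.one_rpow]
      rw [show (1 : ℝ) + 1 = 2 by norm_num, show (2 : ℝ) + 1 = 3 by norm_num,
        show (3 : ℝ) + 1 = 4 by norm_num, show (4 : ℝ) + 1 = 5 by norm_num,
        show (5 : ℝ) + 1 = 6 by norm_num, show (6 : ℝ) + 1 = 7 by norm_num,
        show (7 : ℝ) + 1 = 8 by norm_num]
      norm_num only at *
      linarith

lemma rpow_sub_one_add_le {x : ℝ} (hx : 1 ≤ x) :
    (x - 1) ^ (2.318 : ℝ) + (2 * x - 1) ≤ x ^ (2.318 : ℝ) := by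
  have h : ∀ y : ℝ, 0 ≤ y → y ^ (2.318 : ℝ) = y ^ 2 * y ^ (0.318 : ℝ) := by
    intro y hy
    rw [← Real.rpow_natCast, ← Real.rpow_add_of_nonneg hy (by norm_num) (by norm_num)]
    norm_num
  rw [h _ (by linarith), h _ (by linarith)]
  have h1 : (x - 1) ^ (0.318 : ℝ) ≤ x ^ (0.318 : ℝ) :=
    Real.rpow_le_rpow (by linarith) (by linarith) (by norm_num)
  have h2 : 1 ≤ x ^ (0.318 : ℝ) := Real.one_le_rpow hx (by norm_num)
  nlinarith [sq_nonneg (x - 1)]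

end Numerics

section Sizes

/-- A tree scheme with at most `N ^ 2.318` labels, strictly fewer for nontrivial `N`. -/
def HasSmallTreeScheme (N : ℕ) : Prop :=
  ∃ (L : Type) (_ : Fintype L) (g : L → L → L), IsTreeScheme N g ∧
    (Fintype.card L : ℝ) ≤ (N : ℝ) ^ (2.318 : ℝ) ∧
    (2 ≤ N → (Fintype.card L : ℝ) < (N : ℝ) ^ (2.318 : ℝ))

/-- A spine scheme with at most `2.376083 * N ^ 2.318` labels. -/
def HasSmallSpineScheme (N : ℕ) : Prop :=
  ∃ (L : Type) (_ : Fintype L) (g : L → L → L) (π : L → L), IsSpineScheme N g π ∧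
    (Fintype.card L : ℝ) ≤ 2.376083 * (N : ℝ) ^ (2.318 : ℝ)

lemma card_nodeLabel {N : ℕ} (L₁ L₂ : Type) (L : Fin N → Type) [Fintype L₁] [Fintype L₂]
    [∀ j, Fintype (L j)] : (Fintype.card (NodeLabel L₁ L L₂) : ℝ) =
      Fintype.card L₁ + 1 + ∑ j, (Fintype.card (L j) : ℝ) + Fintype.card L₂ := by
  simp only [Fintype.card_sum, Fintype.card_unit, Fintype.card_sigma]
  push_cast
  ring

lemma natDiv_rpow_le (a b : ℕ) :
    ((a / b : ℕ) : ℝ) ^ (2.318 : ℝ) ≤ (a : ℝ) ^ (2.318 : ℝ) * (b : ℝ) ^ (-2.318 : ℝ) := by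
  calc ((a / b : ℕ) : ℝ) ^ (2.318 : ℝ) ≤ ((a : ℝ) / b) ^ (2.318 : ℝ) :=
        Real.rpow_le_rpow (by positivity) Nat.cast_div_le (by norm_num)
    _ = _ := by
      rw [Real.div_rpow (by positivity) (by positivity), Real.rpow_neg (by positivity),
        div_eq_mul_inv]

lemma HasSmallSpineScheme.of_lt {N : ℕ} (hN : 1 ≤ N) (hs : ∀ k < N, HasSmallSpineScheme k)
    (ht : ∀ k < N, HasSmallTreeScheme k) : HasSmallSpineScheme N := by
  obtain ⟨L₁, _, g₁, π₁, h₁, hc₁⟩ := hs (N / 2) (by omega)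
  have hlt : ∀ j : Fin N, (N - 1) / ((j : ℕ) + 1) < N := fun j =>
    (Nat.div_le_self _ _).trans_lt (by omega)
  choose L _ g h hc _ using fun j : Fin N => ht _ (hlt j)
  refine ⟨NodeLabel L₁ L L₁, inferInstance, _, _, IsSpineScheme.node h₁ h h₁, ?_⟩
  rw [card_nodeLabel]
  have hN' : (1 : ℝ) ≤ N := by exact_mod_cast hN
  have hsum : ∑ j, (Fintype.card (L j) : ℝ) ≤ ((N : ℝ) - 1) ^ (2.318 : ℝ) * 1.4230574 := by
    calc ∑ j, (Fintype.card (L j) : ℝ)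
        ≤ ∑ j : Fin N, ((N : ℝ) - 1) ^ (2.318 : ℝ) * ((j : ℝ) + 1) ^ (-2.318 : ℝ) := by
          refine Finset.sum_le_sum fun j _ => (hc j).trans ?_
          simpa [Nat.cast_sub hN] using natDiv_rpow_le (N - 1) (j + 1)
      _ ≤ _ := by
          rw [← Finset.mul_sum,
            Fin.sum_univ_eq_sum_range (fun j : ℕ => ((j : ℝ) + 1) ^ (-2.318 : ℝ)) N]
          exact mul_le_mul_of_nonneg_left (sum_rpow_le N) (Real.rpow_nonneg (by linarith) _)
  have h2 := natDiv_rpow_le N 2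
  have h2' := mul_le_mul_of_nonneg_left two_rpow_le
    (by positivity : (0 : ℝ) ≤ (N : ℝ) ^ (2.318 : ℝ))
  have hstep := rpow_sub_one_add_le hN'
  have hpos : (0 : ℝ) ≤ (N : ℝ) ^ (2.318 : ℝ) := by positivity
  push_cast at h2
  linarith

lemma HasSmallTreeScheme.of_lt {N : ℕ} (hN : 1 ≤ N) (hs : ∀ k < N, HasSmallSpineScheme k)
    (ht : ∀ k < N, HasSmallTreeScheme k) : HasSmallTreeScheme N := by
  obtain ⟨L₁, _, g₁, π₁, h₁, hc₁⟩ := hs (N / 3) (by omega)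
  have hlt : ∀ j : Fin N, (if (j : ℕ) = 0 then 2 * N / 3 else (N - 1) / ((j : ℕ) + 1)) < N := by
    intro j
    split_ifs
    · omega
    · exact (Nat.div_le_self _ _).trans_lt (by omega)
  choose L _ g h hc _ using fun j : Fin N => ht _ (hlt j)
  have hN' : (1 : ℝ) ≤ N := by exact_mod_cast hN
  have hcard : (Fintype.card (NodeLabel L₁ L Empty) : ℝ) < (N : ℝ) ^ (2.318 : ℝ) ∨
      N = 1 ∧ (Fintype.card (NodeLabel L₁ L Empty) : ℝ) ≤ 1 := by
    rw [card_nodeLabel]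
    simp only [Fintype.card_empty, Nat.cast_zero, add_zero]
    rcases hN.eq_or_lt with rfl | hN2
    · right
      refine ⟨rfl, ?_⟩
      have h0 := hc 0
      norm_num at hc₁ h0 ⊢
      simp_all
    left
    have hN2' : (2 : ℝ) ≤ N := by exact_mod_cast hN2
    obtain ⟨M, rfl⟩ : ∃ M, N = M + 1 := ⟨N - 1, by omega⟩
    have hfirst : (Fintype.card (L 0) : ℝ) ≤ ((M + 1 : ℕ) : ℝ) ^ (2.318 : ℝ) * 0.3906794 := by
      have h0 : (Fintype.card (L 0) : ℝ) ≤ ((2 * (M + 1) / 3 : ℕ) : ℝ) ^ (2.318 : ℝ) := by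
        simpa using hc 0
      have hdiv : ((2 * (M + 1) / 3 : ℕ) : ℝ) ≤ ((M + 1 : ℕ) : ℝ) * (2 / 3) := by
        refine Nat.cast_div_le.trans (le_of_eq ?_)
        push_cast
        ring
      calc (Fintype.card (L 0) : ℝ) ≤ (((M + 1 : ℕ) : ℝ) * (2 / 3)) ^ (2.318 : ℝ) :=
            h0.trans (Real.rpow_le_rpow (by positivity) hdiv (by norm_num))
        _ = ((M + 1 : ℕ) : ℝ) ^ (2.318 : ℝ) * (2 / 3 : ℝ) ^ (2.318 : ℝ) :=
            Real.mul_rpow (by positivity) (by norm_num)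
        _ ≤ _ := by
            gcongr
            exact two_thirds_rpow_le
    have hsum : ∑ j : Fin M, (Fintype.card (L j.succ) : ℝ) ≤
        (((M + 1 : ℕ) : ℝ) - 1) ^ (2.318 : ℝ) * 0.4230574 := by
      calc ∑ j : Fin M, (Fintype.card (L j.succ) : ℝ)
          ≤ ∑ j : Fin M, (((M + 1 : ℕ) : ℝ) - 1) ^ (2.318 : ℝ) *
              (((j + 1 : ℕ) : ℝ) + 1) ^ (-2.318 : ℝ) := by
            refine Finset.sum_le_sum fun j _ => (hc j.succ).trans ?_
            simpa using natDiv_rpow_le M (j + 1 + 1)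
        _ ≤ _ := by
            rw [← Finset.mul_sum,
              Fin.sum_univ_eq_sum_range (fun j : ℕ => (((j + 1 : ℕ) : ℝ) + 1) ^ (-2.318 : ℝ)) M]
            refine mul_le_mul_of_nonneg_left ?_ (Real.rpow_nonneg (by linarith) _)
            have := sum_rpow_le (M + 1)
            rw [Finset.sum_range_succ'] at this
            norm_num at this ⊢
            linarith
    rw [Fin.sum_univ_succ]
    have h3 := natDiv_rpow_le (M + 1) 3
    have h3' := mul_le_mul_of_nonneg_left three_rpow_le
      (by positivity : (0 : ℝ) ≤ ((M + 1 : ℕ) : ℝ) ^ (2.318 : ℝ))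
    have hstep := rpow_sub_one_add_le hN'
    have hpos : (0 : ℝ) < ((M + 1 : ℕ) : ℝ) ^ (2.318 : ℝ) := by positivity
    rw [Nat.cast_ofNat] at h3
    nlinarith
  refine ⟨NodeLabel L₁ L Empty, inferInstance, _, IsTreeScheme.node h₁ h, ?_, ?_⟩
  · rcases hcard with h | ⟨rfl, h⟩
    · exact h.le
    · simpa using h
  · intro hN2
    exact hcard.resolve_right fun h => by omega

lemma hasSmallSchemes (N : ℕ) : HasSmallSpineScheme N ∧ HasSmallTreeScheme N := by
  induction N using Nat.strong_induction_on with
  | _ N ih =>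
    rcases Nat.eq_zero_or_pos N with rfl | hN
    · constructor
      · refine ⟨Empty, inferInstance, fun x _ => x, id, ?_, by
        simp only [Fintype.card_empty, Nat.cast_zero]
        positivity⟩
        intro V _ _ S p _ _ hcard
        obtain rfl := Finset.card_eq_zero.1 (Nat.le_zero.1 hcard)
        exact ⟨fun u hu => absurd hu (Finset.notMem_empty u), ⟨by simp, by simp⟩, by simp⟩
      · refine ⟨Empty, inferInstance, fun x _ => x, ?_, by
        simp only [Fintype.card_empty, Nat.cast_zero]
        positivity, by simp⟩
        intro V _ _ S _ hcard
        obtain rfl := Finset.card_eq_zero.1 (Nat.le_zero.1 hcard)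
        exact ⟨fun u hu => absurd hu (Finset.notMem_empty u), ⟨by simp, by simp⟩⟩
    · exact ⟨.of_lt hN (fun k hk => (ih k hk).1) (fun k hk => (ih k hk).2),
        .of_lt hN (fun k hk => (ih k hk).1) (fun k hk => (ih k hk).2)⟩

end Sizes

section RootedTree

/-- The vertices of a rooted tree, ordered by ancestry. -/
def Vertex (T : FinRootedTree) : Type := Fin T.n

variable (T : FinRootedTree)

lemma isAncestor_antisymm {u v : Fin T.n} (huv : T.IsAncestor u v) (hvu : T.IsAncestor v u) :
    u = v := by
  obtain ⟨k, hk⟩ := huv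
  obtain ⟨l, hl⟩ := hvu
  have hroot : ∀ m, T.parent^[m] T.root = T.root := fun m =>
    Function.iterate_fixed T.parent_root m
  rcases Nat.eq_zero_or_pos k with rfl | hk0
  · exact hk.symm
  have hcyc : T.parent^[l + k] v = v := by rw [Function.iterate_add_apply, hk, hl]
  obtain ⟨m, hm⟩ := T.reaches_root v
  have hv : v = T.root := by
    have h1 : T.parent^[(l + k) * m] v = v := by
      rw [Function.iterate_mul]
      exact Function.iterate_fixed hcyc m
    obtain ⟨d, hd⟩ : ∃ d, (l + k) * m = d + m :=
      ⟨(l + k) * m - m, (Nat.sub_add_cancel (Nat.le_mul_of_pos_left m (by omega))).symm⟩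
    rw [hd, Function.iterate_add_apply, hm, hroot] at h1
    exact h1.symm
  rw [← hk, hv, hroot]

lemma exists_isNCA (u v : Fin T.n) : ∃ w, T.IsNCA u v w := by
  classical
  have hex : ∃ k, T.IsAncestor (T.parent^[k] u) v := by
    obtain ⟨k, hk⟩ := T.reaches_root u
    exact ⟨k, hk ▸ T.reaches_root v⟩
  refine ⟨T.parent^[Nat.find hex] u, ⟨_, rfl⟩, Nat.find_spec hex, ?_⟩
  rintro x ⟨j, rfl⟩ hx
  have hle : Nat.find hex ≤ j := Nat.find_min' hex hx
  exact ⟨j - Nat.find hex, by rw [← Function.iterate_add_apply, Nat.sub_add_cancel hle]⟩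

noncomputable instance : SemilatticeInf (Vertex T) where
  le u v := T.IsAncestor u v
  le_refl u := ⟨0, rfl⟩
  le_trans := by
    rintro u v w ⟨k, rfl⟩ ⟨l, rfl⟩
    exact ⟨k + l, Function.iterate_add_apply _ _ _ _⟩
  le_antisymm _ _ := isAncestor_antisymm T
  inf u v := (exists_isNCA T u v).choose
  inf_le_left u v := (exists_isNCA T u v).choose_spec.1
  inf_le_right u v := (exists_isNCA T u v).choose_spec.2.1
  le_inf x u v h₁ h₂ := (exists_isNCA T u v).choose_spec.2.2 x h₁ h₂

lemma isAncestor_or_isAncestor {a b c : Fin T.n} (ha : T.IsAncestor a c)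
    (hb : T.IsAncestor b c) : T.IsAncestor a b ∨ T.IsAncestor b a := by
  obtain ⟨k, rfl⟩ := ha
  obtain ⟨l, rfl⟩ := hb
  rcases le_total k l with h | h
  · exact .inr ⟨l - k, by rw [← Function.iterate_add_apply, Nat.sub_add_cancel h]⟩
  · exact .inl ⟨k - l, by rw [← Function.iterate_add_apply, Nat.sub_add_cancel h]⟩

lemma isTreeOrder_vertex : IsTreeOrder (Vertex T) := fun _ _ _ => isAncestor_or_isAncestor T

lemma inf_eq_of_isNCA {u v w : Vertex T} (h : T.IsNCA u v w) : u ⊓ v = w :=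
  le_antisymm (h.2.2 _ (inf_le_left : u ⊓ v ≤ u) (inf_le_right : u ⊓ v ≤ v))
    (le_inf (show w ≤ u from h.1) (show w ≤ v from h.2.1))

end RootedTree

end NcaLabeling

open NcaLabeling in
/-- For every `n ≥ 2` there is an NCA-labeling scheme for the family of all rooted trees
on at most `n` vertices with label space of size `m < n ^ 2.318`. -/
theorem nca_labeling_scheme_general (n : ℕ) (hn : 2 ≤ n) :
    ∃ m : ℕ, (m : ℝ) < (n : ℝ) ^ (2.318 : ℝ) ∧
      ∃ g : Fin m → Fin m → Fin m,
        ∀ T : FinRootedTree, T.n ≤ n →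
          ∃ f : Fin T.n → Fin m, Function.Injective f ∧
            ∀ u v w, T.IsNCA u v w → g (f u) (f v) = f w := by
  obtain ⟨L, _, g, hg, -, hcard⟩ := (hasSmallSchemes n).2
  let e := Fintype.equivFin L
  refine ⟨Fintype.card L, hcard hn, fun x y => e (g (e.symm x) (e.symm y)), fun T hT => ?_⟩
  let S : Finset (Vertex T) := (Finset.univ : Finset (Fin T.n))
  have hmem : ∀ u, u ∈ S := fun u => Finset.mem_univ (α := Fin T.n) u
  obtain ⟨f, hf⟩ := hg (Vertex T) (isTreeOrder_vertex T) S (fun _ _ _ _ => hmem _)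
    ((Finset.card_fin T.n).trans_le hT)
  refine ⟨fun u => e (f u (hmem u)), fun u v huv => hf.inj _ _ _ _ (e.injective huv), ?_⟩
  intro u v w h
  have hinf : ∀ w : Vertex T, w = (show Vertex T from u) ⊓ (show Vertex T from v) →
      g (f u (hmem u)) (f v (hmem v)) = f w (hmem w) := by
    rintro _ rfl
    exact hf.map_inf _ _ _ _ _
  simp only [Equiv.symm_apply_apply]
  exact congrArg e (hinf w (inf_eq_of_isNCA T h).symm)
end

section
/- For every natural number n ≥ 2 there exists an NCA-labeling scheme for the family of all rooted binary trees on at most n vertices whose label space has size less than n^{1.894} (equivalently, labels require fewer than 1.894·log₂ n bits): there is a natural number m < n^{1.894}, a decoder g : {0,…,m−1} × {0,…,m−1} → {0,…,m−1}, and for every rooted binary tree T on at most n vertices an injective encoder f_T : V(T) → {0,…,m−1} such that g(f_T(u), f_T(v)) = f_T(nca_T(u,v)) for all u, v ∈ V(T). -/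
/-- Shapes of rooted binary trees; `nil` is the empty tree. -/
inductive BinTree : Type
  | nil : BinTree
  | node : BinTree → BinTree → BinTree

namespace BinTree

/-- The number of vertices. -/
def size : BinTree → ℕ
  | nil => 0
  | node l r => l.size + r.size + 1

/-- The type of vertices of a binary tree. -/
def Pos : BinTree → Type
  | nil => Empty
  | node l r => Option (l.Pos ⊕ r.Pos)

/-- The nearest common ancestor of two vertices. -/
def meet : (t : BinTree) → t.Pos → t.Pos → t.Pos
  | nil, a, _ => a
  | node _ _, none, _ => none
  | node _ _, some _, none => none
  | node l _, some (.inl a), some (.inl b) => some (.inl (l.meet a b))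
  | node _ r, some (.inr a), some (.inr b) => some (.inr (r.meet a b))
  | node _ _, some (.inl _), some (.inr _) => none
  | node _ _, some (.inr _), some (.inl _) => none

theorem nonempty_pos_equiv_fin : ∀ t : BinTree, Nonempty (t.Pos ≃ Fin t.size)
  | nil => ⟨Equiv.equivOfIsEmpty Empty (Fin 0)⟩
  | node l r => by
    obtain ⟨e⟩ := nonempty_pos_equiv_fin l
    obtain ⟨f⟩ := nonempty_pos_equiv_fin r
    exact ⟨(Equiv.optionCongr ((Equiv.sumCongr e f).trans finSumFinEquiv)).trans
      (finSuccEquiv _).symm⟩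

/-- `s.Embeds t` if the vertices of `s` can be injected into those of `t` so that nearest common
ancestors are preserved. -/
def Embeds (s t : BinTree) : Prop :=
  ∃ φ : s.Pos → t.Pos, Function.Injective φ ∧ ∀ a b, t.meet (φ a) (φ b) = φ (s.meet a b)

namespace Embeds

theorem refl (t : BinTree) : t.Embeds t := ⟨id, Function.injective_id, fun _ _ => rfl⟩

theorem trans {s t u : BinTree} : s.Embeds t → t.Embeds u → s.Embeds u := by
  rintro ⟨φ, hφ, hφ'⟩ ⟨ψ, hψ, hψ'⟩
  exact ⟨ψ ∘ φ, hψ.comp hφ, fun a b => by simp [hψ', hφ']⟩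

theorem right (l r : BinTree) : r.Embeds (node l r) :=
  ⟨fun a => some (.inr a), fun _ _ h => Sum.inr.inj (Option.some.inj h), fun _ _ => rfl⟩

theorem swap (l r : BinTree) : (node l r).Embeds (node r l) := by
  refine ⟨Option.map Sum.swap,
    Option.map_injective (Function.LeftInverse.injective Sum.swap_leftInverse), ?_⟩
  rintro (_ | a | a) (_ | b | b) <;> rfl

theorem node {l l' r r' : BinTree} :
    l.Embeds l' → r.Embeds r' → (node l r).Embeds (node l' r') := by
  rintro ⟨φ, hφ, hφ'⟩ ⟨ψ, hψ, hψ'⟩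
  refine ⟨Option.map (Sum.map φ ψ), Option.map_injective (hφ.sumMap hψ), ?_⟩
  rintro (_ | a | a) (_ | b | b) <;> first | rfl | skip
  · exact congrArg (fun x => some (Sum.inl x)) (hφ' a b)
  · exact congrArg (fun x => some (Sum.inr x)) (hψ' a b)

end Embeds

/-- Hang `t` below a path whose vertices carry the trees of the list as their other subtrees. -/
def plug (l : List BinTree) (t : BinTree) : BinTree := l.foldr node t

/-- The number of vertices of such a path together with its hanging subtrees. -/
def weight (l : List BinTree) : ℕ := (l.map fun s => s.size + 1).sum

theorem weight_cons (s : BinTree) (l : List BinTree) :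
    weight (s :: l) = s.size + 1 + weight l := by simp [weight]

theorem exists_split (l : List BinTree) (k : ℕ) (hk : k < weight l) :
    ∃ l₁ s l₂, l = l₁ ++ s :: l₂ ∧ weight l₁ ≤ k ∧ k < weight l₁ + s.size + 1 ∧
      weight l = weight l₁ + s.size + 1 + weight l₂ := by
  induction l generalizing k with
  | nil => simp [weight] at hk
  | cons a l ih =>
    rw [weight_cons] at hk
    by_cases h : k < a.size + 1
    · exact ⟨[], a, l, rfl, by simp [weight], by simpa [weight] using h, by simp [weight]⟩
    · obtain ⟨l₁, s, l₂, rfl, h₁, h₂, h₃⟩ := ih (k - (a.size + 1)) (by omega)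
      refine ⟨a :: l₁, s, l₂, rfl, ?_, ?_, ?_⟩ <;> rw [weight_cons] <;> try omega
      rw [weight_cons, h₃]; omega

/-- Following the heavy path until the subtrees have size at most `b`. -/
theorem exists_heavy_path (b : ℕ) (t : BinTree) (ht : b < t.size) :
    ∃ l h s, t.Embeds (plug l (node h s)) ∧ h.size ≤ b ∧ s.size ≤ h.size ∧
      b < h.size + s.size + 1 ∧ weight l + h.size + s.size + 1 = t.size := by
  induction t with
  | nil => simp [size] at ht
  | node x y ihx ihy =>
    have key : ∀ x y : BinTree, x.size ≤ y.size → b < x.size + y.size + 1 →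
        (b < y.size → ∃ l h s, y.Embeds (plug l (node h s)) ∧ h.size ≤ b ∧ s.size ≤ h.size ∧
          b < h.size + s.size + 1 ∧ weight l + h.size + s.size + 1 = y.size) →
        ∃ l h s, (node x y).Embeds (plug l (node h s)) ∧ h.size ≤ b ∧ s.size ≤ h.size ∧
          b < h.size + s.size + 1 ∧ weight l + h.size + s.size + 1 = x.size + y.size + 1 := by
      intro x y hxy hb ih
      by_cases hy : b < y.size
      · obtain ⟨l, h, s, h₁, h₂, h₃, h₄, h₅⟩ := ih hy
        refine ⟨x :: l, h, s, (Embeds.refl x).node h₁, h₂, h₃, h₄, ?_⟩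
        rw [weight_cons]; omega
      · exact ⟨[], y, x, Embeds.swap x y, by omega, hxy, by omega, by simp [weight]; omega⟩
    rw [size] at ht ⊢
    rcases le_total x.size y.size with h | h
    · exact key x y h ht ihy
    · obtain ⟨l, h, s, h₁, h₂⟩ := key y x h (by omega) ihx
      exact ⟨l, h, s, (Embeds.swap x y).trans h₁, by omega⟩

/-- There is a small tree into which all trees with at most `n` vertices embed. -/
def HasUniversal (n : ℕ) : Prop :=
  ∃ U : BinTree, (U.size : ℝ) ≤ (n : ℝ) ^ (1.894 : ℝ) ∧
    (2 ≤ n → (U.size : ℝ) < (n : ℝ) ^ (1.894 : ℝ)) ∧ ∀ t : BinTree, t.size ≤ n → t.Embeds U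

/-- There is a small path with hanging subtrees into which all such paths of weight at most `n`
embed, with the lower end mapped to the lower end. -/
def HasUniversalSpine (n : ℕ) : Prop :=
  ∃ P : BinTree → BinTree, (∀ X, ((P X).size : ℝ) ≤ 2.166 * (n : ℝ) ^ (1.894 : ℝ) + X.size) ∧
    ∀ l, weight l ≤ n → ∀ t X, t.Embeds X → (plug l t).Embeds (P X)

theorem rpow_le_of_pow_le {a y : ℝ} (ha : 0 ≤ a) (hy : 0 ≤ y) (h : a ^ 947 ≤ y ^ 500) :
    a ^ (1.894 : ℝ) ≤ y := by
  have h1 : (a ^ (1.894 : ℝ)) ^ 500 = a ^ 947 := by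
    rw [← Real.rpow_mul_natCast ha, ← Real.rpow_natCast]
    norm_num
  have h2 := h1.trans_le h
  exact le_of_pow_le_pow_left₀ (n := 500) (Nat.succ_ne_zero 499) hy h2

set_option exponentiation.threshold 2000 in
theorem half_rpow_le : (1 / 2 : ℝ) ^ (1.894 : ℝ) ≤ 0.2691 :=
  rpow_le_of_pow_le (by norm_num) (by norm_num) (by norm_num)

set_option exponentiation.threshold 2000 in
theorem three_tenths_rpow_le : (3 / 10 : ℝ) ^ (1.894 : ℝ) ≤ 0.1024 :=
  rpow_le_of_pow_le (by norm_num) (by norm_num) (by norm_num)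

set_option exponentiation.threshold 2000 in
theorem seven_tenths_rpow_le : (7 / 10 : ℝ) ^ (1.894 : ℝ) ≤ 0.509 :=
  rpow_le_of_pow_le (by norm_num) (by norm_num) (by norm_num)

theorem half_mul_rpow_le {x : ℝ} (hx : 0 ≤ x) {y : ℝ} (hy : 0 ≤ y) (h : y ≤ x / 2) :
    y ^ (1.894 : ℝ) ≤ 0.2691 * x ^ (1.894 : ℝ) := by
  calc y ^ (1.894 : ℝ) ≤ (1 / 2 * x) ^ (1.894 : ℝ) :=
        Real.rpow_le_rpow hy (by linarith) (by norm_num)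
    _ = (1 / 2) ^ (1.894 : ℝ) * x ^ (1.894 : ℝ) := Real.mul_rpow (by norm_num) hx
    _ ≤ _ := by gcongr; exact half_rpow_le

theorem rpow_add_one_le {x : ℝ} (hx : 0 ≤ x) :
    x ^ (1.894 : ℝ) + 1 ≤ (x + 1) ^ (1.894 : ℝ) := by
  simpa using Real.add_rpow_le_rpow_add hx zero_le_one (show (1 : ℝ) ≤ 1.894 by norm_num)

/-- The recursion for spines, splitting at the median. -/
theorem HasUniversalSpine.succ {n : ℕ} (hU : HasUniversal n) (h₁ : HasUniversalSpine ((n + 1) / 2))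
    (h₂ : HasUniversalSpine (n - (n + 1) / 2)) : HasUniversalSpine (n + 1) := by
  obtain ⟨U, hU, -, hU'⟩ := hU
  obtain ⟨P, hP, hP'⟩ := h₁
  obtain ⟨Q, hQ, hQ'⟩ := h₂
  refine ⟨fun X => P (node U (Q X)), fun X => ?_, fun l hl t X htX => ?_⟩
  · have a₁ := hP (node U (Q X))
    have a₂ := hQ X
    have e : (((n + 1 : ℕ) / 2 : ℕ) : ℝ) ≤ ((n : ℝ) + 1) / 2 := by
      have := @Nat.cast_div_le ℝ _ _ _ (n + 1) 2
      push_cast at this; exact this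
    have e' : ((n - (n + 1 : ℕ) / 2 : ℕ) : ℝ) ≤ ((n : ℝ) + 1) / 2 := by
      rw [le_div_iff₀ (by norm_num)]
      exact_mod_cast (by omega : (n - (n + 1) / 2) * 2 ≤ n + 1)
    have b₁ := half_mul_rpow_le (by positivity) (Nat.cast_nonneg _) e
    have b₂ := half_mul_rpow_le (by positivity) (Nat.cast_nonneg _) e'
    have b₃ := rpow_add_one_le (Nat.cast_nonneg (α := ℝ) n)
    have b₄ : (0 : ℝ) ≤ ((n : ℝ) + 1) ^ (1.894 : ℝ) := by positivity
    rw [size] at a₁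
    push_cast at a₁ ⊢
    linarith
  · by_cases h : weight l ≤ (n + 1) / 2
    · exact hP' l h _ _ ((hQ' [] (by simp [weight]) t X htX).trans (Embeds.right _ _))
    · obtain ⟨l₁, s, l₂, rfl, h₁, h₂, h₃⟩ := exists_split l ((n + 1) / 2) (by omega)
      have : plug (l₁ ++ s :: l₂) t = plug l₁ (node s (plug l₂ t)) := by simp [plug]
      rw [this]
      exact hP' l₁ h₁ _ _ ((hU' s (by omega)).node (hQ' l₂ (by omega) t X htX))

theorem recursion_bound {N b : ℝ} (hN : 2 ≤ N) (hb : 0.7 * N ≤ b) (hb' : b ≤ 0.7 * N + 1)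
    (hbN : b ≤ N) :
    2.166 * (N - b) ^ (1.894 : ℝ) + b ^ (1.894 : ℝ) + 0.2691 * N ^ (1.894 : ℝ) + 1 <
      (N + 1) ^ (1.894 : ℝ) := by
  have hN0 : 0 < N := by linarith
  set M := N ^ (1.894 : ℝ) with hM
  have hM0 : 0 < M := by positivity
  obtain ⟨θ, hθ⟩ : ∃ θ, θ = (b - 0.7 * N) / (0.3 * N) := ⟨_, rfl⟩
  have hθ0 : 0 ≤ θ := hθ ▸ div_nonneg (by linarith) (by linarith)
  have hθ1 : θ ≤ 1 := by rw [hθ, div_le_one (by linarith)]; linarith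
  have hbθ : b = (1 - θ) * (7 / 10 * N) + θ * N := by rw [hθ]; field_simp; ring
  have hθN : θ * N ≤ 10 / 3 := by rw [hθ]; field_simp; linarith
  have conv := convexOn_rpow (show (1 : ℝ) ≤ 1.894 by norm_num)
  have c₁ : b ^ (1.894 : ℝ) ≤ (1 - θ) * (7 / 10 * N) ^ (1.894 : ℝ) + θ * M := by
    have := conv.2 (x := 7 / 10 * N) (y := N) (Set.mem_Ici.2 (by linarith))
      (Set.mem_Ici.2 (by linarith)) (sub_nonneg.2 hθ1) hθ0 (by ring)
    rw [hbθ]; simpa only [smul_eq_mul] using this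
  have c₂ : (N - b) ^ (1.894 : ℝ) ≤ (1 - θ) * (3 / 10 * N) ^ (1.894 : ℝ) := by
    have := conv.2 (x := 3 / 10 * N) (y := 0) (Set.mem_Ici.2 (by linarith))
      (Set.mem_Ici.2 le_rfl) (sub_nonneg.2 hθ1) hθ0 (by ring)
    simp only [smul_eq_mul, mul_zero, add_zero] at this
    rw [Real.zero_rpow (by norm_num), mul_zero, add_zero] at this
    rwa [show N - b = (1 - θ) * (3 / 10 * N) by rw [hbθ]; ring]
  rw [Real.mul_rpow (by norm_num) hN0.le] at c₁ c₂
  have d₁ : (1 - θ) * ((7 / 10) ^ (1.894 : ℝ) * M) ≤ (1 - θ) * (0.509 * M) := by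
    have := sub_nonneg.2 hθ1
    gcongr; exact seven_tenths_rpow_le
  have d₂ : (1 - θ) * ((3 / 10) ^ (1.894 : ℝ) * M) ≤ (1 - θ) * (0.1024 * M) := by
    have := sub_nonneg.2 hθ1
    gcongr; exact three_tenths_rpow_le
  obtain ⟨K, hK⟩ : ∃ K, K = N ^ (0.894 : ℝ) := ⟨_, rfl⟩
  have hMK : M = N * K := by
    rw [hM, hK, ← Real.rpow_one_add' hN0.le (by norm_num)]; norm_num
  have hK1 : 1.2 ≤ K := by
    have h1 : (2 : ℝ) ^ (0.5 : ℝ) ≤ N ^ (0.894 : ℝ) :=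
      (Real.rpow_le_rpow_of_exponent_le (by norm_num) (by norm_num)).trans
        (Real.rpow_le_rpow (by norm_num) hN (by norm_num))
    have h2 : (1.2 : ℝ) ≤ (2 : ℝ) ^ (0.5 : ℝ) := by
      rw [show (0.5 : ℝ) = 1 / 2 by norm_num, ← Real.sqrt_eq_rpow]
      exact Real.le_sqrt_of_sq_le (by norm_num)
    rw [hK]; exact h2.trans h1
  have hlow : M + 1.894 * K ≤ (N + 1) ^ (1.894 : ℝ) := by
    have h := one_add_mul_self_le_rpow_one_add (s := 1 / N)
      (by have : 0 < 1 / N := by positivity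
          linarith) (show (1 : ℝ) ≤ 1.894 by norm_num)
    have h' : N + 1 = N * (1 + 1 / N) := by field_simp
    rw [h', Real.mul_rpow hN0.le (by positivity), ← hM]
    calc M + 1.894 * K = M * (1 + 1.894 * (1 / N)) := by rw [hMK]; field_simp
      _ ≤ _ := by gcongr
  have hθM : θ * M ≤ 10 / 3 * K := by
    rw [hMK, ← mul_assoc]; gcongr
  nlinarith

/-- The recursion for trees: the upper part of the heavy path, then the two subtrees of the lowest
vertex whose subtree is large. -/
theorem HasUniversal.succ {N : ℕ} (hP : HasUniversalSpine (N - (7 * N + 9) / 10))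
    (h₁ : HasUniversal ((7 * N + 9) / 10)) (h₂ : HasUniversal (N / 2)) :
    HasUniversal (N + 1) := by
  obtain ⟨P, hP, hP'⟩ := hP
  obtain ⟨U, hU, -, hU'⟩ := h₁
  obtain ⟨W, hW, -, hW'⟩ := h₂
  obtain ⟨b, hb⟩ : ∃ b, b = (7 * N + 9) / 10 := ⟨_, rfl⟩
  rw [← hb] at hP hP' hU hU'
  have hbN : b ≤ N := by omega
  have hsize : ((P (node U W)).size : ℝ) ≤ 2.166 * ((N : ℝ) - b) ^ (1.894 : ℝ) +
      (b : ℝ) ^ (1.894 : ℝ) + ((N / 2 : ℕ) : ℝ) ^ (1.894 : ℝ) + 1 := by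
    have := hP (node U W)
    rw [size, Nat.cast_sub hbN] at this
    push_cast at this
    linarith
  have hlt : 2 ≤ N + 1 → ((P (node U W)).size : ℝ) < ((N + 1 : ℕ) : ℝ) ^ (1.894 : ℝ) := by
    intro h
    rcases (show N = 1 ∨ 2 ≤ N by omega) with rfl | hN
    · obtain rfl : b = 1 := by omega
      have h2 := Real.rpow_lt_rpow_of_exponent_lt (x := 2) (by norm_num)
        (show (1 : ℝ) < 1.894 by norm_num)
      have h0 : (0 : ℝ) ^ (1.894 : ℝ) = 0 := Real.zero_rpow (by norm_num)
      simp only [Nat.cast_one, sub_self, Nat.reduceDiv, Nat.cast_zero, h0, Real.one_rpow] at hsize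
      rw [Real.rpow_one] at h2
      exact hsize.trans_lt (lt_of_eq_of_lt (by norm_num) h2)
    · have e : ((N / 2 : ℕ) : ℝ) ≤ (N : ℝ) / 2 := Nat.cast_div_le
      have b₁ := half_mul_rpow_le (by positivity) (Nat.cast_nonneg _) e
      have hb₁ : 7 * (N : ℝ) ≤ 10 * b := by exact_mod_cast (by omega : 7 * N ≤ 10 * b)
      have hb₂ : 10 * (b : ℝ) ≤ 7 * N + 9 := by exact_mod_cast (by omega : 10 * b ≤ 7 * N + 9)
      have := recursion_bound (N := N) (b := b) (by exact_mod_cast hN) (by linarith)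
        (by linarith) (by exact_mod_cast hbN)
      push_cast
      linarith
  refine ⟨P (node U W), ?_, hlt, fun t ht => ?_⟩
  · rcases Nat.eq_zero_or_pos N with rfl | hN
    · obtain rfl : b = 0 := by omega
      norm_num at hsize ⊢
      exact hsize
    · exact (hlt (by omega)).le
  · by_cases h : t.size ≤ b
    · exact hP' [] (by simp [weight]) _ _
        ((hU' t h).trans ((Embeds.right W U).trans (Embeds.swap W U)))
    · obtain ⟨l, h, s, a₁, a₂, a₃, a₄, a₅⟩ := exists_heavy_path b t (by omega)
      exact a₁.trans (hP' l (by omega) _ _ ((hU' h a₂).node (hW' s (by omega))))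

theorem hasUniversal_and_spine (n : ℕ) : HasUniversal n ∧ HasUniversalSpine n := by
  induction n using Nat.strong_induction_on with
  | _ n ih =>
    rcases n with _ | n
    · refine ⟨⟨nil, by simp [size]; positivity, by simp, fun t ht => ?_⟩, id, fun X => ?_, fun l hl t X h => ?_⟩
      · cases t with
        | nil => exact Embeds.refl _
        | node => simp [size] at ht
      · simp; positivity
      · cases l with
        | nil => exact h
        | cons => rw [weight_cons] at hl; omega
    · exact ⟨.succ (ih _ (by omega)).2 (ih _ (by omega)).1 (ih _ (by omega)).1,
        .succ (ih _ (by omega)).1 (ih _ (by omega)).2 (ih _ (by omega)).2⟩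

end BinTree

namespace FinRootedTree

variable (T : FinRootedTree)

/-- The set of vertices that have an ancestor in `C`. -/
def below (C : Set (Fin T.n)) : Set (Fin T.n) := {u | ∃ c ∈ C, T.IsAncestor c u}

/-- `S` embeds into the binary tree `t`, preserving nearest common ancestors. -/
def EmbedsOn (S : Set (Fin T.n)) (t : BinTree) : Prop :=
  ∃ f : S → t.Pos, Function.Injective f ∧
    ∀ u v w : S, T.IsNCA u v w → t.meet (f u) (f v) = f w

open Classical in
/-- The distance to the root. -/
noncomputable def depth (v : Fin T.n) : ℕ := Nat.find (T.reaches_root v)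

variable {T}

theorem depth_parent (v : Fin T.n) : T.depth (T.parent v) = T.depth v - 1 := by
  classical
  apply le_antisymm
  · apply Nat.find_min'
    have h := Nat.find_spec (T.reaches_root v)
    change T.parent^[T.depth v] v = T.root at h
    rcases hd : T.depth v with _ | d
    · rw [hd] at h
      simp only [Function.iterate_zero, id] at h ⊢
      subst h; exact T.parent_root
    · rw [hd] at h; exact h
  · have : T.depth v ≤ T.depth (T.parent v) + 1 :=
      Nat.find_min' _ (Nat.find_spec (T.reaches_root (T.parent v)))
    omega

theorem depth_iterate (k : ℕ) (v : Fin T.n) : T.depth (T.parent^[k] v) = T.depth v - k := by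
  induction k with
  | zero => rfl
  | succ k ih => rw [Function.iterate_succ_apply', depth_parent, ih]; omega

theorem eq_root_of_depth {v : Fin T.n} (h : T.depth v = 0) : v = T.root := by
  classical
  have := Nat.find_spec (T.reaches_root v)
  change T.parent^[T.depth v] v = T.root at this
  rwa [h] at this

theorem IsAncestor.eq_of_depth_le {u v : Fin T.n} (h : T.IsAncestor u v)
    (hd : T.depth v ≤ T.depth u) : u = v := by
  obtain ⟨k, rfl⟩ := h
  have := depth_iterate k v
  rcases k with _ | k
  · rfl
  · rw [eq_root_of_depth (v := v) (by omega), Function.iterate_fixed T.parent_root]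

theorem IsAncestor.refl (v : Fin T.n) : T.IsAncestor v v := ⟨0, rfl⟩

theorem IsAncestor.trans {u v w : Fin T.n} (h : T.IsAncestor u v) (h' : T.IsAncestor v w) :
    T.IsAncestor u w := by
  obtain ⟨i, rfl⟩ := h
  obtain ⟨j, rfl⟩ := h'
  exact ⟨i + j, Function.iterate_add_apply _ _ _ _⟩

theorem IsAncestor.total {u v w : Fin T.n} (h : T.IsAncestor u w) (h' : T.IsAncestor v w) :
    T.IsAncestor u v ∨ T.IsAncestor v u := by
  obtain ⟨i, rfl⟩ := h
  obtain ⟨j, rfl⟩ := h'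
  rcases le_total i j with hij | hij <;> obtain ⟨k, rfl⟩ := Nat.exists_eq_add_of_le' hij
  · exact .inr ⟨k, (Function.iterate_add_apply _ _ _ _).symm⟩
  · exact .inl ⟨k, (Function.iterate_add_apply _ _ _ _).symm⟩

theorem IsAncestor.antisymm {u v : Fin T.n} (h : T.IsAncestor u v) (h' : T.IsAncestor v u) :
    u = v := by
  apply h.eq_of_depth_le
  obtain ⟨k, rfl⟩ := h'
  rw [depth_iterate]; omega

/-- The set of children of `v`. -/
def children (T : FinRootedTree) (v : Fin T.n) : Set (Fin T.n) := {u | T.parent u = v ∧ u ≠ v}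

theorem depth_of_mem_children {v c : Fin T.n} (h : c ∈ T.children v) :
    T.depth c = T.depth v + 1 := by
  obtain ⟨rfl, h⟩ := h
  have h1 : T.depth c ≠ 0 := fun h0 => h (by rw [eq_root_of_depth h0, T.parent_root])
  rw [depth_parent]; omega

theorem isAncestor_of_mem_children {v c : Fin T.n} (h : c ∈ T.children v) : T.IsAncestor v c :=
  ⟨1, h.1⟩

theorem eq_of_mem_children {v a b u : Fin T.n} (ha : a ∈ T.children v) (hb : b ∈ T.children v)
    (hau : T.IsAncestor a u) (hbu : T.IsAncestor b u) : a = b := by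
  have h1 := depth_of_mem_children ha
  have h2 := depth_of_mem_children hb
  rcases hau.total hbu with h | h
  · exact h.eq_of_depth_le (by omega)
  · exact (h.eq_of_depth_le (by omega)).symm

theorem not_mem_below {v : Fin T.n} {C : Set (Fin T.n)} (hC : C ⊆ T.children v) :
    v ∉ T.below C := by
  rintro ⟨c, hc, h⟩
  exact (hC hc).2 (h.antisymm (isAncestor_of_mem_children (hC hc)))

theorem below_singleton_eq (v : Fin T.n) :
    T.below {v} = insert v (T.below (T.children v)) := by
  ext u
  constructor
  · rintro ⟨_, rfl, k, hk⟩
    induction k generalizing u with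
    | zero => exact .inl hk
    | succ k ih =>
      rcases ih (T.parent u) hk with h | ⟨c, hc, h⟩
      · by_cases hu : u = T.parent u
        · exact .inl (hu.trans h)
        · exact .inr ⟨u, ⟨h, h ▸ hu⟩, IsAncestor.refl u⟩
      · exact .inr ⟨c, hc, h.trans ⟨1, rfl⟩⟩
  · rintro (rfl | ⟨c, hc, h⟩)
    · exact ⟨u, rfl, IsAncestor.refl u⟩
    · exact ⟨v, rfl, (isAncestor_of_mem_children hc).trans h⟩

theorem below_union (A B : Set (Fin T.n)) : T.below (A ∪ B) = T.below A ∪ T.below B := by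
  ext u
  simp only [below, Set.mem_union, Set.mem_ofPred_eq, or_and_right, exists_or]

theorem IsNCA.symm {u v w : Fin T.n} (h : T.IsNCA u v w) : T.IsNCA v u w :=
  ⟨h.2.1, h.1, fun x hx hx' => h.2.2 x hx' hx⟩

/-- Joining the embeddings of the two subtrees of a vertex. -/
theorem EmbedsOn.node {v : Fin T.n} {A B : Set (Fin T.n)} {l r : BinTree}
    (hA : A.Subsingleton) (hB : B.Subsingleton) (hAB : Disjoint A B)
    (hC : T.children v = A ∪ B) (hl : T.EmbedsOn (T.below A) l) (hr : T.EmbedsOn (T.below B) r) :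
    T.EmbedsOn (T.below {v}) (.node l r) := by
  classical
  obtain ⟨f, hf, hf'⟩ := hl
  obtain ⟨g, hg, hg'⟩ := hr
  have hAC : A ⊆ T.children v := hC ▸ Set.subset_union_left
  have hBC : B ⊆ T.children v := hC ▸ Set.subset_union_right
  have hcase : ∀ u : T.below {v}, (u : Fin T.n) = v ∨ (u : Fin T.n) ∈ T.below A ∨
      (u : Fin T.n) ∈ T.below B := by
    rintro ⟨u, hu⟩
    rwa [below_singleton_eq, hC, below_union] at hu
  have hvA := not_mem_below hAC
  have hvB := not_mem_below hBC
  have hdisj : ∀ u, u ∈ T.below A → u ∉ T.below B := by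
    rintro u ⟨a, ha, hau⟩ ⟨b, hb, hbu⟩
    obtain rfl := eq_of_mem_children (hAC ha) (hBC hb) hau hbu
    exact Set.disjoint_left.1 hAB ha hb
  have hanc : ∀ {C : Set (Fin T.n)} {x u}, x ∈ T.below C → T.IsAncestor x u → u ∈ T.below C :=
    fun ⟨c, hc, h⟩ h' => ⟨c, hc, h.trans h'⟩
  have hclosed : ∀ {C : Set (Fin T.n)} {u w x}, C.Subsingleton → u ∈ T.below C →
      w ∈ T.below C → T.IsNCA u w x → x ∈ T.below C := by
    rintro C u w x hC ⟨c, hc, hcu⟩ ⟨d, hd, hdw⟩ h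
    obtain rfl := hC hc hd
    exact ⟨c, hc, h.2.2 c hcu hdw⟩
  let F : T.below {v} → Option (l.Pos ⊕ r.Pos) := fun u =>
    if hA : (u : Fin T.n) ∈ T.below A then some (.inl (f ⟨u, hA⟩))
    else if hB : (u : Fin T.n) ∈ T.below B then some (.inr (g ⟨u, hB⟩)) else none
  have Fv : ∀ u : T.below {v}, (u : Fin T.n) = v → F u = none := fun u h => by
    simp only [F]; rw [dif_neg fun h' => hvA (h ▸ h'), dif_neg fun h' => hvB (h ▸ h')]
  have FA : ∀ (u : T.below {v}) (h : (u : Fin T.n) ∈ T.below A),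
      F u = some (.inl (f ⟨u, h⟩)) := fun u h => by simp only [F]; rw [dif_pos h]
  have FB : ∀ (u : T.below {v}) (h : (u : Fin T.n) ∈ T.below B),
      F u = some (.inr (g ⟨u, h⟩)) := fun u h => by
    simp only [F]; rw [dif_neg fun h' => hdisj _ h' h, dif_pos h]
  have hvx : ∀ u w x : T.below {v}, (u : Fin T.n) = v → T.IsNCA u w x → (x : Fin T.n) = v := by
    rintro u w ⟨x, w', rfl, hx⟩ hu h
    exact (show T.IsAncestor x w' from hu ▸ h.1).antisymm hx
  have hAB' : ∀ u w x : T.below {v}, (u : Fin T.n) ∈ T.below A → (w : Fin T.n) ∈ T.below B →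
      T.IsNCA u w x → (x : Fin T.n) = v := by
    intro u w x hu hw h
    rcases hcase x with hx | hx | hx
    · exact hx
    · exact absurd hw (hdisj _ (hanc hx h.2.1))
    · exact absurd (hanc hx h.1) (hdisj _ hu)
  refine ⟨F, fun u w huw => ?_, fun u w x h => ?_⟩
  · rcases hcase u with hu | hu | hu <;> rcases hcase w with hw | hw | hw
    · exact Subtype.ext (hu.trans hw.symm)
    · rw [Fv u hu, FA w hw] at huw; cases huw
    · rw [Fv u hu, FB w hw] at huw; cases huw
    · rw [FA u hu, Fv w hw] at huw; cases huw
    · rw [FA u hu, FA w hw] at huw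
      exact Subtype.ext (Subtype.mk.inj (hf (Sum.inl.inj (Option.some.inj huw))))
    · rw [FA u hu, FB w hw] at huw; cases Option.some.inj huw
    · rw [FB u hu, Fv w hw] at huw; cases huw
    · rw [FB u hu, FA w hw] at huw; cases Option.some.inj huw
    · rw [FB u hu, FB w hw] at huw
      exact Subtype.ext (Subtype.mk.inj (hg (Sum.inr.inj (Option.some.inj huw))))
  · rcases hcase u with hu | hu | hu <;> rcases hcase w with hw | hw | hw
    · rw [Fv u hu, Fv x (hvx u w x hu h)]; rfl
    · rw [Fv u hu, Fv x (hvx u w x hu h)]; rfl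
    · rw [Fv u hu, Fv x (hvx u w x hu h)]; rfl
    · rw [FA u hu, Fv w hw, Fv x (hvx w u x hw h.symm)]; rfl
    · have hx := hclosed hA hu hw h
      rw [FA u hu, FA w hw, FA x hx]
      exact congrArg (fun y => some (Sum.inl y)) (hf' ⟨u, hu⟩ ⟨w, hw⟩ ⟨x, hx⟩ h)
    · rw [FA u hu, FB w hw, Fv x (hAB' u w x hu hw h)]; rfl
    · rw [FB u hu, Fv w hw, Fv x (hvx w u x hw h.symm)]; rfl
    · rw [FB u hu, FA w hw, Fv x (hAB' w u x hw hu h.symm)]; rfl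
    · have hx := hclosed hB hu hw h
      rw [FB u hu, FB w hw, FB x hx]
      exact congrArg (fun y => some (Sum.inr y)) (hg' ⟨u, hu⟩ ⟨w, hw⟩ ⟨x, hx⟩ h)

theorem exists_disjoint_subsingletons {α : Type*} [Finite α] {C : Set α} (hC : C.ncard ≤ 2) :
    ∃ A B : Set α, A.Subsingleton ∧ B.Subsingleton ∧ Disjoint A B ∧ C = A ∪ B := by
  rcases C.eq_empty_or_nonempty with rfl | ⟨a, ha⟩
  · exact ⟨∅, ∅, by simp⟩
  · refine ⟨{a}, C \ {a}, Set.subsingleton_singleton, ?_, Set.disjoint_sdiff_right, ?_⟩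
    · rw [← Set.ncard_le_one_iff_subsingleton, Set.ncard_sdiff_singleton_of_mem ha]
      omega
    · rw [Set.union_sdiff_cancel (Set.singleton_subset_iff.2 ha)]

theorem IsBinary.exists_embedsOn (hT : T.IsBinary) (v : Fin T.n) :
    ∃ t : BinTree, t.size ≤ (T.below {v}).ncard ∧ T.EmbedsOn (T.below {v}) t := by
  induction hk : (T.below {v}).ncard using Nat.strong_induction_on generalizing v with
  | _ k ih =>
    subst hk
    obtain ⟨A, B, hA, hB, hAB, hC⟩ := exists_disjoint_subsingletons (hT v)
    change T.children v = A ∪ B at hC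
    have hAC : A ⊆ T.children v := hC ▸ Set.subset_union_left
    have hBC : B ⊆ T.children v := hC ▸ Set.subset_union_right
    have hcard : (T.below {v}).ncard = (T.below A).ncard + (T.below B).ncard + 1 := by
      rw [below_singleton_eq, Set.ncard_insert_of_notMem (not_mem_below subset_rfl), hC,
        below_union, Set.ncard_union_eq]
      rw [Set.disjoint_left]
      rintro u ⟨a, ha, hau⟩ ⟨b, hb, hbu⟩
      obtain rfl := eq_of_mem_children (hAC ha) (hBC hb) hau hbu
      exact Set.disjoint_left.1 hAB ha hb
    have hsub : ∀ C : Set (Fin T.n), C.Subsingleton →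
        (T.below C).ncard < (T.below {v}).ncard →
        ∃ t : BinTree, t.size ≤ (T.below C).ncard ∧ T.EmbedsOn (T.below C) t := by
      intro C hC hlt
      rcases hC.eq_empty_or_singleton with rfl | ⟨c, rfl⟩
      · have : ∀ u : T.below ∅, False := fun ⟨_, _, h, _⟩ => h
        exact ⟨.nil, Nat.zero_le _, fun u => (this u).elim, fun u => (this u).elim,
          fun u => (this u).elim⟩
      · exact ih _ hlt c rfl
    obtain ⟨l, hl, hl'⟩ := hsub A hA (by omega)
    obtain ⟨r, hr, hr'⟩ := hsub B hB (by omega)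
    exact ⟨.node l r, by rw [BinTree.size]; omega, hl'.node hA hB hAB hC hr'⟩

end FinRootedTree

/-- For every `n ≥ 2` there is an NCA-labeling scheme for the family of all rooted binary
trees on at most `n` vertices with label space of size `m < n ^ 1.894`. -/
theorem nca_labeling_scheme_binary (n : ℕ) (hn : 2 ≤ n) :
    ∃ m : ℕ, (m : ℝ) < (n : ℝ) ^ (1.894 : ℝ) ∧
      ∃ g : Fin m → Fin m → Fin m,
        ∀ T : FinRootedTree, T.IsBinary → T.n ≤ n →
          ∃ f : Fin T.n → Fin m, Function.Injective f ∧
            ∀ u v w, T.IsNCA u v w → g (f u) (f v) = f w := by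
  obtain ⟨U, -, hlt, hU⟩ := (BinTree.hasUniversal_and_spine n).1
  obtain ⟨e⟩ := U.nonempty_pos_equiv_fin
  refine ⟨U.size, hlt hn, fun i j => e (U.meet (e.symm i) (e.symm j)), fun T hT hTn => ?_⟩
  obtain ⟨t, ht, f, hf, hf'⟩ := hT.exists_embedsOn T.root
  have hle : (T.below {T.root}).ncard ≤ T.n := by
    simpa using Set.ncard_le_card (T.below {T.root})
  obtain ⟨φ, hφ, hφ'⟩ := hU t (by omega)
  have hmem : ∀ u, u ∈ T.below {T.root} := fun u => ⟨_, rfl, T.reaches_root u⟩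
  refine ⟨fun u => e (φ (f ⟨u, hmem u⟩)), fun u v huv => ?_, fun u v w h => ?_⟩
  · exact congrArg Subtype.val (hf (hφ (e.injective huv)))
  · simp only [Equiv.symm_apply_apply, hφ']
    rw [hf' ⟨u, hmem u⟩ ⟨v, hmem v⟩ ⟨w, hmem w⟩ h]
end

section
/- For every natural number n ≥ 1 there exists a rooted tree S with at most n² vertices that is NCA-universal for the family of all rooted binary trees on at most n vertices; that is, for every rooted binary tree T with at most n vertices there is an injective map φ : V(T) → V(S) such that φ(nca_T(u,v)) = nca_S(φ(u), φ(v)) for all vertices u, v of T. -/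
/-- Binary trees in which the two (possibly empty) subtrees are indexed by `Bool`. -/
inductive BinShape where
  | nil : BinShape
  | node : (Bool → BinShape) → BinShape

namespace BinShape

/-- The number of vertices. -/
def size : BinShape → ℕ
  | nil => 0
  | node c => 1 + (c false).size + (c true).size

/-- The vertices, each given by the word of directions leading to it from the root. -/
def words : BinShape → Finset (List Bool)
  | nil => ∅
  | node c => insert [] (Finset.univ.biUnion fun b => (c b).words.image (List.cons b))

@[simp] lemma notMem_words_nil (p : List Bool) : p ∉ words nil := by simp [words]

@[simp] lemma nil_mem_words_node (c : Bool → BinShape) : [] ∈ words (node c) := by simp [words]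

@[simp] lemma cons_mem_words_node (c : Bool → BinShape) (b : Bool) (p : List Bool) :
    b :: p ∈ words (node c) ↔ p ∈ words (c b) := by
  simp only [words, Finset.mem_insert, Finset.mem_biUnion, Finset.mem_image]
  constructor
  · rintro (h | ⟨b', -, q, hq, h⟩)
    · cases h
    · cases h; exact hq
  · intro h
    exact Or.inr ⟨b, Finset.mem_univ _, p, h, rfl⟩

lemma card_words (t : BinShape) : t.words.card = t.size := by
  induction t with
  | nil => rfl
  | node c ih =>
    rw [words, Finset.card_insert_of_notMem (by simp), Finset.card_biUnion]
    · simp only [Finset.card_image_of_injective _ (List.cons_injective), ih, size,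
        Fintype.sum_bool]
      omega
    · intro a _ b _ hab
      simp only [Finset.disjoint_left, Finset.mem_image]
      rintro _ ⟨q, -, rfl⟩ ⟨q', -, h⟩
      exact hab (List.cons.inj h).1.symm

lemma mem_words_of_append {t : BinShape} {p q : List Bool} (h : p ++ q ∈ t.words) :
    p ∈ t.words := by
  induction t generalizing p with
  | nil => simp at h
  | node c ih =>
    cases p with
    | nil => simp
    | cons b p => simpa using ih b (by simpa using h)

lemma exists_words_eq (P : Finset (List Bool)) (hP : ∀ p b, p ++ [b] ∈ P → p ∈ P) :
    ∃ t : BinShape, t.words = P := by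
  induction hn : P.card using Nat.strong_induction_on generalizing P with
  | _ n ih =>
  rcases P.eq_empty_or_nonempty with rfl | ⟨q, hq⟩
  · exact ⟨nil, rfl⟩
  have hnil : [] ∈ P := by
    induction q using List.reverseRecOn with
    | nil => exact hq
    | append_singleton p b ihp => exact ihp (hP p b hq)
  have key (b : Bool) : ∃ t : BinShape, ∀ p, p ∈ t.words ↔ b :: p ∈ P := by
    let Q := P.preimage (List.cons b) List.cons_injective.injOn
    have hQ : ∀ p, p ∈ Q ↔ b :: p ∈ P := fun p => Finset.mem_preimage
    have hlt : Q.card < n := by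
      rw [← hn, ← Finset.card_image_of_injective Q (List.cons_injective (a := b))]
      refine Finset.card_lt_card ⟨?_, fun h => ?_⟩
      · intro p hp
        obtain ⟨q, hq, rfl⟩ := Finset.mem_image.1 hp
        exact (hQ q).1 hq
      · simpa using h hnil
    obtain ⟨t, ht⟩ := ih _ hlt Q (fun p b' h => (hQ p).2 (hP _ b' ((hQ _).1 h))) rfl
    exact ⟨t, fun p => by rw [ht, hQ]⟩
  choose c hc using key
  refine ⟨node c, ?_⟩
  ext p
  cases p with
  | nil => simpa using hnil
  | cons b p => simp [hc]

/-- Embeddings of binary trees that preserve nearest common ancestors. -/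
inductive Emb : BinShape → BinShape → Prop
  | nil (t : BinShape) : Emb nil t
  | sub (s : BinShape) (c : Bool → BinShape) (b : Bool) : Emb s (c b) → Emb s (node c)
  | node (a c : Bool → BinShape) (σ : Bool → Bool) (hσ : Function.Injective σ) :
      (∀ b, Emb (a b) (c (σ b))) → Emb (node a) (node c)

lemma Emb.exists_map {s t : BinShape} (h : Emb s t) :
    ∃ (f : List Bool → List Bool) (γ : List Bool → Bool → Bool),
      (∀ p, Function.Injective (γ p)) ∧ (∀ p ∈ s.words, f p ∈ t.words) ∧
        ∀ p b, p ++ [b] ∈ s.words → f p ++ [γ p b] <+: f (p ++ [b]) := by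
  induction h with
  | nil t => exact ⟨id, fun _ => id, fun _ => Function.injective_id, by simp, by simp⟩
  | sub s c b _ ih =>
    obtain ⟨f, γ, hγ, hf, hfγ⟩ := ih
    exact ⟨fun p => b :: f p, γ, hγ, fun p hp => by simpa using hf p hp,
      fun p b' h => by simpa using hfγ p b' h⟩
  | node a c σ hσ _ ih =>
    choose f γ hγ hf hfγ using ih
    refine ⟨fun p => p.casesOn [] fun b q => σ b :: f b q,
      fun p => p.casesOn σ fun b q => γ b q, ?_, ?_, ?_⟩
    · rintro (_ | ⟨b, q⟩)
      exacts [hσ, hγ b q]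
    · rintro (_ | ⟨b, q⟩) h
      · simp
      · simpa using hf b q (by simpa using h)
    · rintro (_ | ⟨b, q⟩) b' h
      · simp
      · simpa using hfγ b q b' (by simpa using h)

/-- The tree consisting of a path ending in `t`, with the trees of the list hanging off it. -/
def plug (C : List BinShape) (t : BinShape) : BinShape :=
  C.foldr (fun s u => node fun b => bif b then u else s) t

/-- The number of vertices that `plug C` adds. -/
def csize (C : List BinShape) : ℕ := (C.map fun s => s.size + 1).sum

@[simp] lemma csize_nil : csize [] = 0 := rfl

@[simp] lemma csize_cons (s : BinShape) (C : List BinShape) :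
    csize (s :: C) = s.size + 1 + csize C := by simp [csize]

@[simp] lemma csize_append (C D : List BinShape) : csize (C ++ D) = csize C + csize D := by
  simp [csize]

lemma size_plug (C : List BinShape) (t : BinShape) : (plug C t).size = csize C + t.size := by
  induction C with
  | nil => simp [plug]
  | cons s C ih =>
    change 1 + s.size + (plug C t).size = _
    rw [ih, csize_cons]
    omega

lemma size_node (c : Bool → BinShape) (b : Bool) :
    (node c).size = 1 + (c b).size + (c !b).size := by
  cases b <;> simp only [size, Bool.not_false, Bool.not_true]
  omega

lemma xor_injective (b : Bool) : Function.Injective (xor b) := by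
  intro x y; simp

lemma emb_plug_right {s t : BinShape} (C : List BinShape) (h : Emb s t) : Emb s (plug C t) := by
  induction C with
  | nil => exact h
  | cons k C ih => exact Emb.sub _ _ true ih

lemma emb_node_plug (c : Bool → BinShape) (b : Bool) {K C : List BinShape} {u : BinShape}
    (h : List.SublistForall₂ Emb (c (!b) :: K) C)
    (ih : ∀ D, List.SublistForall₂ Emb K D → Emb (c b) (plug D u)) :
    Emb (node c) (plug C u) := by
  induction C with
  | nil => cases h
  | cons k C ihC =>
    cases h with
    | cons hk hK =>
      refine Emb.node _ _ (xor (!b)) (xor_injective (!b)) fun b' => ?_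
      have h' := ih C hK
      simp only [plug] at h'
      cases b <;> cases b' <;> simp_all
    | cons_right hK => exact Emb.sub _ _ true (ihC hK)

/-- Cut a tree at the last vertex of a path with at most `x` vertices outside its subtree. -/
lemma exists_cut (s : BinShape) (x : ℕ) (hx : x < s.size) :
    ∃ (K : List BinShape) (c : Bool → BinShape),
      csize K + (node c).size = s.size ∧ csize K ≤ x ∧ (∀ b, (c b).size + x < s.size) ∧
        ∀ C u, List.SublistForall₂ Emb K C → Emb (node c) u → Emb s (plug C u) := by
  induction s generalizing x with
  | nil => simp [size] at hx
  | node c ih =>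
    by_cases hc : ∀ b, (c b).size + x < (node c).size
    · exact ⟨[], c, by simp, by simp, hc, fun C u _ h => emb_plug_right C h⟩
    push Not at hc
    obtain ⟨b, hb⟩ := hc
    have hs := size_node c b
    obtain ⟨K, d, h₁, h₂, h₃, h₄⟩ := ih b (x - (1 + (c !b).size)) (by omega)
    refine ⟨c (!b) :: K, d, ?_, ?_, ?_, ?_⟩
    · rw [csize_cons]; omega
    · rw [csize_cons]; omega
    · intro b'
      have := h₃ b'
      omega
    · intro C u hC hu
      exact emb_node_plug c b hC fun D hD => h₄ D u hD hu

lemma csize_split (K : List BinShape) (x : ℕ) :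
    csize K ≤ x ∨ ∃ K₁ k K₂, K = K₁ ++ k :: K₂ ∧ csize K₁ ≤ x ∧
      x < csize K₁ + k.size + 1 := by
  induction K generalizing x with
  | nil => simp
  | cons s K ih =>
    by_cases hs : s.size + 1 ≤ x
    · rcases ih (x - (s.size + 1)) with h | ⟨K₁, k, K₂, rfl, h₁, h₂⟩
      · left; rw [csize_cons]; omega
      · refine Or.inr ⟨s :: K₁, k, K₂, rfl, ?_, ?_⟩ <;> rw [csize_cons] <;> omega
    · exact Or.inr ⟨[], s, K, rfl, by simp, by simp; omega⟩

lemma sublistForall₂_append {K₁ K₂ C₁ C₂ : List BinShape}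
    (h₁ : List.SublistForall₂ Emb K₁ C₁) (h₂ : List.SublistForall₂ Emb K₂ C₂) :
    List.SublistForall₂ Emb (K₁ ++ K₂) (C₁ ++ C₂) := by
  rw [List.sublistForall₂_iff] at *
  obtain ⟨l₁, h₁, h₁'⟩ := h₁
  obtain ⟨l₂, h₂, h₂'⟩ := h₂
  exact ⟨l₁ ++ l₂, List.rel_append h₁ h₂, h₁'.append h₂'⟩

/-- Every tree with at most `n` vertices embeds into `U`. -/
def Universal (n : ℕ) (U : BinShape) : Prop := ∀ s : BinShape, s.size ≤ n → Emb s U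

/-- Every list of trees with total weight at most `n` embeds into `C`. -/
def ListUniversal (n : ℕ) (C : List BinShape) : Prop :=
  ∀ K : List BinShape, csize K ≤ n → List.SublistForall₂ Emb K C

lemma listUniversal_step {m : ℕ} {C₁ C₂ : List BinShape} {U : BinShape} (hm : 1 ≤ m)
    (h₁ : ListUniversal ((m - 1) / 2) C₁) (hU : Universal (m - 1) U)
    (h₂ : ListUniversal (m / 2) C₂) : ListUniversal m (C₁ ++ U :: C₂) := by
  intro K hK
  rcases csize_split K ((m - 1) / 2) with h | ⟨K₁, k, K₂, rfl, hK₁, hk⟩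
  · simpa using sublistForall₂_append (h₁ K h) (List.SublistForall₂.nil (l := U :: C₂))
  · rw [csize_append, csize_cons] at hK
    exact sublistForall₂_append (h₁ K₁ hK₁)
      (.cons (hU k (by omega)) (h₂ K₂ (by omega)))

lemma universal_step {n : ℕ} {C : List BinShape} {U₁ U₂ : BinShape} (hn : 1 ≤ n)
    (hC : ListUniversal ((n - 1) / 2) C) (h₁ : Universal ((n - 1) / 2) U₁)
    (h₂ : Universal (n / 2) U₂) :
    Universal n (plug C (node fun b => bif b then U₂ else U₁)) := by
  intro s hs
  rcases Nat.eq_zero_or_pos s.size with h0 | h0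
  · cases s with
    | nil => exact Emb.nil _
    | node c => simp [size] at h0
  obtain ⟨K, c, hsize, hK, hc, hemb⟩ := exists_cut s (min ((n - 1) / 2) (s.size - 1)) (by omega)
  refine hemb C _ (hC K (by omega)) ?_
  obtain ⟨b, hb⟩ : ∃ b, (c b).size ≤ (n - 1) / 2 := by
    by_contra! h
    have := h false
    have := h true
    rw [size] at hsize
    omega
  have hb' := hc (!b)
  refine Emb.node _ _ (xor b) (xor_injective b) fun b' => ?_
  have e₁ := h₁ _ hb
  have e₂ := h₂ (c !b) (by omega)
  cases b <;> cases b' <;> simp_all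

lemma exists_universal (n : ℕ) :
    (∃ U : BinShape, U.size ≤ n ^ 2 ∧ Universal n U) ∧
      ∃ C : List BinShape, csize C ≤ 2 * n ^ 2 ∧ ListUniversal n C := by
  induction n using Nat.strong_induction_on with
  | _ n ih =>
  rcases Nat.eq_zero_or_pos n with rfl | hn
  · refine ⟨⟨nil, by simp [size], fun s hs => ?_⟩, ⟨[], by simp, fun K hK => ?_⟩⟩
    · cases s with
      | nil => exact Emb.nil _
      | node c => simp [size] at hs
    · cases K with
      | nil => exact .nil
      | cons k K => simp at hK
  obtain ⟨⟨U₁, hU₁, hU₁'⟩, ⟨C₁, hC₁, hC₁'⟩⟩ := ih ((n - 1) / 2) (by omega)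
  obtain ⟨⟨U₂, hU₂, hU₂'⟩, ⟨C₂, hC₂, hC₂'⟩⟩ := ih (n / 2) (by omega)
  obtain ⟨⟨U₃, hU₃, hU₃'⟩, -⟩ := ih (n - 1) (by omega)
  refine ⟨⟨_, ?_, universal_step hn hC₁' hU₁' hU₂'⟩, ⟨_, ?_, listUniversal_step hn hC₁' hU₃' hC₂'⟩⟩
  · rw [size_plug]
    simp only [size, cond_false, cond_true]
    rcases Nat.even_or_odd' n with ⟨k, rfl | rfl⟩
    · obtain ⟨j, rfl⟩ : ∃ j, k = j + 1 := ⟨k - 1, by omega⟩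
      rw [show (2 * (j + 1) - 1) / 2 = j by omega] at *
      rw [show 2 * (j + 1) / 2 = j + 1 by omega] at *
      nlinarith
    · rw [show (2 * k + 1 - 1) / 2 = k by omega] at *
      rw [show (2 * k + 1) / 2 = k by omega] at *
      nlinarith
  · rw [csize_append, csize_cons]
    rcases Nat.even_or_odd' n with ⟨k, rfl | rfl⟩
    · obtain ⟨j, rfl⟩ : ∃ j, k = j + 1 := ⟨k - 1, by omega⟩
      rw [show (2 * (j + 1) - 1) / 2 = j by omega] at *
      rw [show 2 * (j + 1) / 2 = j + 1 by omega] at *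
      rw [show 2 * (j + 1) - 1 = 2 * j + 1 by omega] at *
      nlinarith
    · rw [show (2 * k + 1 - 1) / 2 = k by omega] at *
      rw [show (2 * k + 1) / 2 = k by omega] at *
      rw [show 2 * k + 1 - 1 = 2 * k by omega] at *
      nlinarith

end BinShape

/-- A finite prefix-closed set of words is the vertex set of a rooted tree whose ancestor
relation is the prefix relation. -/
lemma FinRootedTree.exists_of_words (P : Finset (List Bool)) (hnil : [] ∈ P)
    (hP : ∀ p q, p ++ q ∈ P → p ∈ P) :
    ∃ (S : FinRootedTree) (e : Fin S.n ≃ P), S.n = P.card ∧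
      ∀ i j, IsAncestorOf S.parent i j ↔ (e i : List Bool) <+: e j := by
  have hinit (l : List Bool) : l.dropLast <+: l := by grind
  have hdrop (p : P) : p.1.dropLast ∈ P := by
    obtain ⟨q, hq⟩ := hinit p.1
    exact hP _ q (by rw [hq]; exact p.2)
  let e : Fin P.card ≃ P := P.equivFin.symm
  let par : Fin P.card → Fin P.card := fun i => e.symm ⟨(e i).1.dropLast, hdrop (e i)⟩
  have hpar (i) : (e (par i)).1 = (e i).1.dropLast := by simp [par]
  have hanc (i j) : IsAncestorOf par i j ↔ (e i : List Bool) <+: e j := by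
    constructor
    · rintro ⟨k, rfl⟩
      induction k with
      | zero => exact List.prefix_rfl
      | succ k ih =>
        rw [Function.iterate_succ_apply', hpar]
        exact (hinit _).trans ih
    · intro h
      obtain ⟨l, hl⟩ : ∃ l, (e j).1.length = l := ⟨_, rfl⟩
      induction l generalizing j with
      | zero =>
        rw [List.length_eq_zero_iff] at hl
        rw [hl, List.prefix_nil, ← hl] at h
        exact ⟨0, (e.injective (Subtype.ext h)).symm⟩
      | succ l ih =>
        by_cases hij : (e i).1 = (e j).1
        · exact ⟨0, (e.injective (Subtype.ext hij)).symm⟩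
        obtain ⟨q, hq⟩ := h
        have hq0 : q ≠ [] := by
          rintro rfl
          exact hij (by simpa using hq)
        obtain ⟨k, hk⟩ := ih (par j)
          (by rw [hpar, ← hq, List.dropLast_append_of_ne_nil hq0]; exact List.prefix_append _ _)
          (by rw [hpar, List.length_dropLast, hl]; rfl)
        exact ⟨k + 1, by rw [Function.iterate_succ_apply, hk]⟩
  refine ⟨⟨P.card, Finset.card_pos.2 ⟨_, hnil⟩, par, e.symm ⟨[], hnil⟩, ?_, ?_⟩, e, rfl, hanc⟩
  · apply e.injective
    apply Subtype.ext
    rw [hpar]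
    simp
  · intro v
    exact (hanc _ v).2 (by simp)

namespace FinRootedTree

variable (T : FinRootedTree)

lemma eq_root_of_parent_eq {v : Fin T.n} (h : T.parent v = v) : v = T.root := by
  obtain ⟨k, hk⟩ := T.reaches_root v
  rw [← hk, Function.iterate_fixed h]

lemma isAncestorOf_root (v : Fin T.n) : IsAncestorOf T.parent T.root v := T.reaches_root v

/-- Two vertices are comparable, or they lie below distinct children of a common vertex. -/
lemma comparable_or_exists_siblings (u v : Fin T.n) :
    IsAncestorOf T.parent u v ∨ IsAncestorOf T.parent v u ∨
      ∃ c c', c ≠ c' ∧ c ≠ T.root ∧ c' ≠ T.root ∧ T.parent c = T.parent c' ∧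
        IsAncestorOf T.parent c u ∧ IsAncestorOf T.parent c' v := by
  classical
  have hex : ∃ k, IsAncestorOf T.parent (T.parent^[k] u) v := by
    obtain ⟨k, hk⟩ := T.reaches_root u
    exact ⟨k, hk ▸ T.isAncestorOf_root v⟩
  rcases hk : Nat.find hex with _ | j
  · left
    have h := Nat.find_spec hex
    rwa [hk] at h
  have hmin : ¬ IsAncestorOf T.parent (T.parent^[j] u) v := Nat.find_min hex (by omega)
  have hw : IsAncestorOf T.parent (T.parent^[j + 1] u) v := hk ▸ Nat.find_spec hex
  rcases hm : Nat.find hw with _ | m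
  · right; left
    have h := Nat.find_spec hw
    rw [hm] at h
    exact ⟨j + 1, h.symm⟩
  have hmin' : T.parent^[m] v ≠ T.parent^[j + 1] u := Nat.find_min hw (by omega)
  have hw' : T.parent^[m + 1] v = T.parent^[j + 1] u := hm ▸ Nat.find_spec hw
  rw [Function.iterate_succ_apply', Function.iterate_succ_apply'] at hw'
  rw [Function.iterate_succ_apply'] at hmin'
  refine Or.inr (Or.inr ⟨T.parent^[j] u, T.parent^[m] v, ?_, ?_, ?_, hw'.symm, ⟨j, rfl⟩, ⟨m, rfl⟩⟩)
  · intro h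
    exact hmin ⟨m, h.symm⟩
  · intro h
    exact hmin (h ▸ T.isAncestorOf_root v)
  · intro h
    rw [h, T.parent_root] at hw'
    exact hmin' (h.trans hw')

/-- Label the vertices so that siblings get distinct labels. -/
lemma IsBinary.exists_labels {T : FinRootedTree} (hT : T.IsBinary) :
    ∃ β : Fin T.n → Bool, ∀ c c', c ≠ c' → c ≠ T.root → c' ≠ T.root →
      T.parent c = T.parent c' → β c ≠ β c' := by
  classical
  have key (v : Fin T.n) : ∃ β : Fin T.n → Bool,
      Set.InjOn β {u : Fin T.n | T.parent u = v ∧ u ≠ v} := by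
    rcases Set.eq_empty_or_nonempty {u : Fin T.n | T.parent u = v ∧ u ≠ v} with h | ⟨a, ha⟩
    · exact ⟨fun _ => false, by simp [h]⟩
    refine ⟨fun u => decide (u = a), fun x hx y hy hxy => ?_⟩
    by_contra hne
    have hxy' : x = a ↔ y = a := by simpa using hxy
    have hxa : x ≠ a := fun h => hne (h.trans (hxy'.1 h).symm)
    have hya : y ≠ a := fun h => hxa (hxy'.2 h)
    have h3 : ({x, y, a} : Set (Fin T.n)).ncard = 3 := Set.ncard_eq_three.2
      ⟨x, y, a, hne, hxa, hya, rfl⟩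
    have hle := Set.ncard_le_ncard (s := {x, y, a})
      (t := {u : Fin T.n | T.parent u = v ∧ u ≠ v})
      (by rintro z (rfl | rfl | rfl) <;> assumption) (Set.toFinite _)
    have := hT v
    omega
  choose β hβ using key
  refine ⟨fun u => β (T.parent u) u, fun c c' hne hc hc' hp h => ?_⟩
  refine hne (hβ (T.parent c) ⟨rfl, fun h => hc (T.eq_root_of_parent_eq h.symm)⟩
    ⟨hp.symm, fun h => hc' (T.eq_root_of_parent_eq (hp.symm.trans h.symm))⟩ ?_)
  simpa only [hp] using h

/-- The words read off from a labelling along the paths from the root. -/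
lemma exists_address (β : Fin T.n → Bool) :
    ∃ a : Fin T.n → List Bool, a T.root = [] ∧
      ∀ v, v ≠ T.root → a v = a (T.parent v) ++ [β v] := by
  classical
  let d : Fin T.n → ℕ := fun v => Nat.find (T.reaches_root v)
  have hd (v) (hv : v ≠ T.root) : d v = d (T.parent v) + 1 := by
    refine (Nat.find_eq_iff _).2 ⟨?_, fun k hk h => ?_⟩
    · rw [Function.iterate_succ_apply]
      exact Nat.find_spec (T.reaches_root (T.parent v))
    · cases k with
      | zero => exact hv h
      | succ k => exact Nat.find_min (T.reaches_root (T.parent v)) (by simpa [d] using hk) h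
  have h0 : d T.root = 0 := (Nat.find_eq_zero _).2 rfl
  refine ⟨fun v => ((List.range (d v)).map fun k => β (T.parent^[k] v)).reverse, ?_, ?_⟩
  · simp [h0]
  · intro v hv
    simp only [hd v hv, List.range_succ_eq_map, List.map_cons, List.map_map, List.reverse_cons]
    rfl

/-- A map to words that sends each child strictly below its parent, with siblings going in
different directions, is injective and preserves nearest common ancestors. -/
lemma injective_and_nca_of_local (β : Fin T.n → Bool) (ψ : Fin T.n → List Bool)
    (hβ : ∀ c c', c ≠ c' → c ≠ T.root → c' ≠ T.root → T.parent c = T.parent c' → β c ≠ β c')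
    (hψ : ∀ c, c ≠ T.root → ψ (T.parent c) ++ [β c] <+: ψ c) :
    Function.Injective ψ ∧ ∀ u v w, IsNcaOf T.parent u v w →
      ψ w <+: ψ u ∧ ψ w <+: ψ v ∧ ∀ x, x <+: ψ u → x <+: ψ v → x <+: ψ w := by
  have hstep (c) : ψ (T.parent c) <+: ψ c := by
    by_cases hc : c = T.root
    · rw [hc, T.parent_root]
    · exact (List.prefix_append _ _).trans (hψ c hc)
  have hanc {u v} (h : IsAncestorOf T.parent u v) : ψ u <+: ψ v := by
    obtain ⟨k, rfl⟩ := h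
    induction k with
    | zero => exact List.prefix_rfl
    | succ k ih =>
      rw [Function.iterate_succ_apply']
      exact (hstep _).trans ih
  have heq {u v} (h : IsAncestorOf T.parent u v) (he : ψ u = ψ v) : u = v := by
    obtain ⟨k, rfl⟩ := h
    cases k with
    | zero => rfl
    | succ k =>
      by_cases hv : v = T.root
      · rw [hv, Function.iterate_fixed T.parent_root]
      · have h₁ := (hψ v hv).length_le
        have h₂ : ψ (T.parent^[k + 1] v) <+: ψ (T.parent v) :=
          hanc ⟨k, (Function.iterate_succ_apply _ _ _).symm⟩
        have h₃ := h₂.length_le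
        rw [he] at h₃
        rw [List.length_append, List.length_singleton] at h₁
        omega
  have hsib {u v c c'} (hne : c ≠ c') (hc : c ≠ T.root) (hc' : c' ≠ T.root)
      (hp : T.parent c = T.parent c') (hu : IsAncestorOf T.parent c u)
      (hv : IsAncestorOf T.parent c' v) (x : List Bool) (hxu : x <+: ψ u) (hxv : x <+: ψ v) :
      x <+: ψ (T.parent c) := by
    have h₁ : ψ (T.parent c) ++ [β c] <+: ψ u := (hψ c hc).trans (hanc hu)
    have h₂ : ψ (T.parent c) ++ [β c'] <+: ψ v := hp ▸ (hψ c' hc').trans (hanc hv)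
    by_cases hx : x.length ≤ (ψ (T.parent c)).length
    · exact List.prefix_of_prefix_length_le hxu ((List.prefix_append _ _).trans h₁) hx
    · have h₃ : ψ (T.parent c) ++ [β c] <+: x :=
        List.prefix_of_prefix_length_le h₁ hxu (by simp; omega)
      have h₄ := List.prefix_of_prefix_length_le (h₃.trans hxv) h₂ (by simp)
      have h₅ := h₄.eq_of_length (by simp)
      exact absurd (by simpa using h₅) (hβ c c' hne hc hc' hp)
  refine ⟨fun u v huv => ?_, fun u v w ⟨hwu, hwv, hw⟩ => ⟨hanc hwu, hanc hwv, fun x hxu hxv => ?_⟩⟩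
  · rcases T.comparable_or_exists_siblings u v with h | h | ⟨c, c', hne, hc, hc', hp, hu, hv⟩
    · exact heq h huv
    · exact (heq h huv.symm).symm
    · have h := (hsib hne hc hc' hp hu hv (ψ u) List.prefix_rfl (by rw [huv])).length_le
      have h' := ((hψ c hc).trans (hanc hu)).length_le
      rw [List.length_append, List.length_singleton] at h'
      omega
  · rcases T.comparable_or_exists_siblings u v with h | h | ⟨c, c', hne, hc, hc', hp, hu, hv⟩
    · exact hxu.trans (hanc (hw u ⟨0, rfl⟩ h))
    · exact hxv.trans (hanc (hw v h ⟨0, rfl⟩))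
    · refine (hsib hne hc hc' hp hu hv x hxu hxv).trans (hanc (hw _ ?_ ?_))
      · obtain ⟨k, rfl⟩ := hu
        exact ⟨k + 1, Function.iterate_succ_apply' _ _ _⟩
      · obtain ⟨k, rfl⟩ := hv
        exact ⟨k + 1, (Function.iterate_succ_apply' _ _ _).trans hp.symm⟩

end FinRootedTree

/-- For every `n ≥ 1` there is a rooted tree `S` with at most `n ^ 2` vertices
that is NCA-universal for the family of all rooted binary trees on at most `n` vertices. -/
theorem nca_universal_tree_binary_quadratic (n : ℕ) (hn : 1 ≤ n) :
    ∃ S : FinRootedTree, S.n ≤ n ^ 2 ∧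
      ∀ T : FinRootedTree, T.IsBinary → T.n ≤ n →
        ∃ φ : Fin T.n → Fin S.n, NcaEmbedding T S φ := by
  obtain ⟨⟨U, hU, huniv⟩, -⟩ := BinShape.exists_universal n
  have hnil : [] ∈ U.words := by
    have h := huniv (.node fun _ => .nil) (by simpa [BinShape.size] using hn)
    cases h <;> simp
  obtain ⟨S, e, hS, hanc⟩ := FinRootedTree.exists_of_words U.words hnil
    fun p q => BinShape.mem_words_of_append
  refine ⟨S, by rw [hS, BinShape.card_words]; exact hU, fun T hT hTn => ?_⟩
  obtain ⟨β, hβ⟩ := hT.exists_labels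
  obtain ⟨a, ha0, ha⟩ := T.exists_address β
  obtain ⟨t, ht⟩ := BinShape.exists_words_eq (Finset.univ.image a) (by
    intro p b h
    obtain ⟨v, -, hv⟩ := Finset.mem_image.1 h
    have hv0 : v ≠ T.root := by
      rintro rfl
      simp [ha0] at hv
    rw [ha v hv0] at hv
    exact Finset.mem_image.2 ⟨T.parent v, Finset.mem_univ _, (List.append_inj' hv rfl).1⟩)
  have hat (v) : a v ∈ t.words := ht ▸ Finset.mem_image_of_mem a (Finset.mem_univ v)
  have htn : t.size ≤ n := by
    rw [← BinShape.card_words, ht]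
    exact Finset.card_image_le.trans (by simpa using hTn)
  obtain ⟨f, γ, hγ, hf, hfγ⟩ := (huniv t htn).exists_map
  obtain ⟨hinj, hnca⟩ := T.injective_and_nca_of_local (fun v => γ (a (T.parent v)) (β v))
    (fun v => f (a v))
    (fun c c' hne hc hc' hp h => hβ c c' hne hc hc' hp (hγ _ (by simpa only [hp] using h)))
    (fun c hc => by
      have h := hfγ (a (T.parent c)) (β c) (ha c hc ▸ hat c)
      rwa [← ha c hc] at h)
  have he (v) : (e (e.symm ⟨f (a v), hf _ (hat v)⟩)).1 = f (a v) := by simp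
  refine ⟨fun v => e.symm ⟨f (a v), hf _ (hat v)⟩, fun u v huv => ?_, fun u v w hw => ?_⟩
  · exact hinj (congrArg Subtype.val (e.symm.injective huv))
  · obtain ⟨h₁, h₂, h₃⟩ := hnca u v w hw
    refine ⟨(hanc _ _).2 (by rwa [he, he]), (hanc _ _).2 (by rwa [he, he]), fun x hxu hxv => ?_⟩
    rw [hanc, he] at *
    exact h₃ _ hxu hxv
end

section
/- For every rooted tree T on n vertices and every real parameter λ ∈ (0,1], there exists a vertex v ∈ V(T) such that removing the edges from v to its children splits T into connected components with the following properties: every component rooted at a child of v has at most ⌊(1−λ)·n⌋ vertices, and the remaining component, which contains v and the root of T, has at most ⌈λ·n⌉ vertices. -/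
/-- The component of the root after removing the edges from `v` to its children:
the vertices that do not lie strictly below `v`. -/
def FinRootedTree.rootComponent (T : FinRootedTree) (v : Fin T.n) : Set (Fin T.n) :=
  {u | T.IsAncestor v u → u = v}

/-- The subtree rooted at a vertex `c`. -/
def FinRootedTree.subtree (T : FinRootedTree) (c : Fin T.n) : Set (Fin T.n) :=
  {u | T.IsAncestor c u}

namespace FinRootedTree

theorem iterate_parent_root (T : FinRootedTree) (k : ℕ) : T.parent^[k] T.root = T.root :=
  Function.iterate_fixed T.parent_root k

theorem eq_root_of_isPeriodicPt (T : FinRootedTree) {c : Fin T.n} {j : ℕ} (hj : 0 < j)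
    (hc : Function.IsPeriodicPt T.parent j c) : c = T.root := by
  obtain ⟨k, hk⟩ := T.reaches_root c
  have hle : k ≤ j * k := Nat.le_mul_of_pos_left k hj
  calc c = T.parent^[j * k] c := (hc.mul_const k).symm
    _ = T.parent^[j * k - k + k] c := by rw [Nat.sub_add_cancel hle]
    _ = T.root := by rw [Function.iterate_add_apply, hk, iterate_parent_root]

theorem subtree_root (T : FinRootedTree) : T.subtree T.root = Set.univ :=
  Set.eq_univ_of_forall T.reaches_root

theorem subtree_ssubset_subtree_parent (T : FinRootedTree) {c : Fin T.n} (hc : c ≠ T.parent c) :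
    T.subtree c ⊂ T.subtree (T.parent c) := by
  refine (Set.ssubset_iff_of_subset ?_).2 ⟨T.parent c, ⟨0, rfl⟩, ?_⟩
  · rintro u ⟨k, rfl⟩
    exact ⟨k + 1, Function.iterate_succ_apply' _ _ _⟩
  · rintro ⟨k, hk⟩
    have hper : Function.IsPeriodicPt T.parent (k + 1) c := hk
    have hroot := T.eq_root_of_isPeriodicPt k.succ_pos hper
    exact hc (by rw [hroot, T.parent_root])

theorem ncard_rootComponent_add_ncard_subtree_le (T : FinRootedTree) (v : Fin T.n) :
    (T.rootComponent v).ncard + (T.subtree v).ncard ≤ T.n + 1 := by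
  have hsub : T.rootComponent v ⊆ insert v (T.subtree v)ᶜ := by
    intro u hu
    by_cases h : T.IsAncestor v u
    · exact Or.inl (hu h)
    · exact Or.inr h
  have hle := (Set.ncard_le_ncard hsub).trans (Set.ncard_insert_le _ _)
  have hcompl := Set.ncard_add_ncard_compl (T.subtree v)
  rw [Nat.card_fin] at hcompl
  omega

/-- A vertex whose subtree is smallest among the subtrees with more than `m` vertices. -/
theorem exists_lt_ncard_subtree (T : FinRootedTree) {m : ℕ} (hm : m < T.n) :
    ∃ v : Fin T.n, m < (T.subtree v).ncard ∧
      ∀ c : Fin T.n, T.parent c = v → c ≠ v → (T.subtree c).ncard ≤ m := by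
  obtain ⟨v, hv, hmin⟩ := Set.exists_min_image {v : Fin T.n | m < (T.subtree v).ncard}
    (fun v => (T.subtree v).ncard) (Set.toFinite _)
    ⟨T.root, by simpa [subtree_root] using hm⟩
  refine ⟨v, hv, ?_⟩
  rintro c rfl hc
  by_contra! hlt
  exact (hmin c hlt).not_gt (Set.ncard_lt_ncard (T.subtree_ssubset_subtree_parent hc))

end FinRootedTree

/-- Splitting lemma: for every rooted tree `T` on `n` vertices and every `λ ∈ (0,1]` there is
a vertex `v` such that removing the edges from `v` to its children leaves a root component
of size at most `⌈λ·n⌉` while every component rooted at a child of `v` has size at most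
`⌊(1-λ)·n⌋`. -/
theorem tree_splitting (n : ℕ) (T : FinRootedTree) (hT : T.n = n)
    (lam : ℝ) (h0 : 0 < lam) (h1 : lam ≤ 1) :
    ∃ v : Fin T.n,
      (T.rootComponent v).ncard ≤ ⌈lam * (n : ℝ)⌉₊ ∧
      ∀ c : Fin T.n, T.parent c = v → c ≠ v →
        (T.subtree c).ncard ≤ ⌊(1 - lam) * (n : ℝ)⌋₊ := by
  subst hT
  have hn : (0 : ℝ) < T.n := Nat.cast_pos.2 T.pos
  have hm : ⌊(1 - lam) * (T.n : ℝ)⌋₊ < T.n :=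
    (Nat.floor_lt (mul_nonneg (sub_nonneg.2 h1) hn.le)).2 (by nlinarith)
  obtain ⟨v, hv, hchild⟩ := T.exists_lt_ncard_subtree hm
  refine ⟨v, ?_, hchild⟩
  have hsum := T.ncard_rootComponent_add_ncard_subtree_le v
  have hround : T.n ≤ ⌈lam * (T.n : ℝ)⌉₊ + ⌊(1 - lam) * (T.n : ℝ)⌋₊ := by
    rw [← tsub_le_iff_left]
    refine Nat.le_floor ?_
    have hceil := Nat.le_ceil (lam * (T.n : ℝ))
    rw [Nat.cast_sub (Nat.ceil_le.2 (by nlinarith))]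
    linarith
  omega
end

section
/- Let L be a finite set and let g : L × L → L be a symmetric function (g(x,y) = g(y,x)) satisfying consistency properties (I), (II), (III). Say that v is the parent of u if g(u,v) = v, u ≠ v, and there is no w with w ∉ {u, v}, g(u,w) = w and g(w,v) = v. Then every element u ∈ L has at most one parent. -/
/-- Consistency of a decoder `g` (properties (I), (II), (III)). -/
def ConsistentDecoder {L : Type*} (g : L → L → L) : Prop :=
  (∀ x y z, g x y = z → g x z = z ∧ g y z = z) ∧
  (∀ x y z, g x y = y → g y z = z → g x z = z) ∧
  (∀ x y z, g x y = y → g x z = z → g y z = y ∨ g y z = z)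

/-- `v` is the parent of `u`: `v` is a strict ancestor of `u` and no `w ∉ {u, v}` lies
strictly between them. -/
def IsParentOf {L : Type*} (g : L → L → L) (u v : L) : Prop :=
  g u v = v ∧ u ≠ v ∧ ¬ ∃ w : L, w ≠ u ∧ w ≠ v ∧ g u w = w ∧ g w v = v

/-- For a symmetric consistent decoder on a finite label set, every element has at most
one parent. -/
theorem parent_unique (L : Type*) [Fintype L] (g : L → L → L)
    (hsymm : ∀ x y, g x y = g y x) (hcons : ConsistentDecoder g) :
    ∀ u v v' : L, IsParentOf g u v → IsParentOf g u v' → v = v' := by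
  rintro u v v' ⟨huv, hne, hmin⟩ ⟨huv', hne', hmin'⟩
  by_contra h
  rcases hcons.2.2 u v v' huv huv' with h₁ | h₁
  · exact hmin ⟨v', hne'.symm, Ne.symm h, huv', (hsymm v' v).trans h₁⟩
  · exact hmin' ⟨v, hne.symm, h, huv, h₁⟩
end

section
/- Let L be a finite set and let g : L × L → L be a symmetric function (g(x,y) = g(y,x)) satisfying consistency properties (I), (II), (III). Call u ∈ L a root if u has no strict ancestor, i.e., there is no v ≠ u with g(u,v) = v. Then L contains at most one root. -/
/-- `u` is a root for the decoder `g` if it has no strict ancestor. -/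
def IsRootLabel {L : Type*} (g : L → L → L) (u : L) : Prop :=
  ¬ ∃ v : L, v ≠ u ∧ g u v = v

/-- For a symmetric consistent decoder on a finite label set, there is at most one root. -/
theorem root_unique (L : Type*) [Fintype L] (g : L → L → L)
    (hsymm : ∀ x y, g x y = g y x) (hcons : ConsistentDecoder g) :
    ∀ u v : L, IsRootLabel g u → IsRootLabel g v → u = v := by
  intro u v hu hv
  obtain ⟨huw, hvw⟩ := hcons.1 u v (g u v) rfl
  have h₁ : g u v = u := by_contra fun h => hu ⟨_, h, huw⟩
  have h₂ : g u v = v := by_contra fun h => hv ⟨_, h, hvw⟩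
  exact h₁.symm.trans h₂
end

section
/- There exist real numbers λ ∈ (0, 1/2] and β ≤ 1.894 with β > 1 and 2^{1−β} < 1 such that, setting c = 1/(1 − 2^{1−β}), the inequality (1−λ)^β + c·λ^β + (1/2)^β ≤ 1 holds. (One valid choice is λ = 0.296149… and β = 1.89311….) -/
/-- A bound on a rational power of a nonnegative real, from a comparison of natural powers. -/
theorem Real.rpow_natCast_div_le_of_pow_le_pow {x y : ℝ} {p q : ℕ} (hx : 0 ≤ x) (hy : 0 ≤ y)
    (hq : q ≠ 0) (h : x ^ p ≤ y ^ q) : x ^ ((p : ℝ) / q) ≤ y := by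
  refine le_of_pow_le_pow_left₀ hq hy ?_
  rwa [← Real.rpow_mul_natCast hx, div_mul_cancel₀ _ (Nat.cast_ne_zero.mpr hq),
    Real.rpow_natCast]

/-- There exist `λ ∈ (0, 1/2]` and `β ≤ 1.894` with `β > 1` and `2 ^ (1-β) < 1` such that,
with `c = 1 / (1 - 2 ^ (1-β))`, the inequality
`(1-λ) ^ β + c · λ ^ β + (1/2) ^ β ≤ 1` holds
(one valid choice is `λ = 0.296149…`, `β = 1.89311…`). -/
theorem binary_recursion_exponent :
    ∃ lam β : ℝ, 0 < lam ∧ lam ≤ 1 / 2 ∧ β ≤ 1.894 ∧ 1 < β ∧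
      (2 : ℝ) ^ (1 - β) < 1 ∧
      (1 - lam) ^ β + (1 / (1 - (2 : ℝ) ^ (1 - β))) * lam ^ β + (1 / 2 : ℝ) ^ β ≤ 1 := by
  have hA : (1 - 0.296 : ℝ) ^ (89 / 47 : ℝ) ≤ 0.51448 := by
    exact_mod_cast Real.rpow_natCast_div_le_of_pow_le_pow (p := 89) (q := 47)
      (x := 1 - 0.296) (y := 0.51448) (by norm_num) (by norm_num) (by norm_num) (by norm_num)
  have hB : (0.296 : ℝ) ^ (89 / 47 : ℝ) ≤ 0.09974 := by
    exact_mod_cast Real.rpow_natCast_div_le_of_pow_le_pow (p := 89) (q := 47)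
      (x := 0.296) (y := 0.09974) (by norm_num) (by norm_num) (by norm_num) (by norm_num)
  have hC : (1 / 2 : ℝ) ^ (89 / 47 : ℝ) ≤ 0.26914 := by
    exact_mod_cast Real.rpow_natCast_div_le_of_pow_le_pow (p := 89) (q := 47)
      (x := 1 / 2) (y := 0.26914) (by norm_num) (by norm_num) (by norm_num) (by norm_num)
  have h_two : (2 : ℝ) ^ (1 - 89 / 47 : ℝ) = 2 * (1 / 2 : ℝ) ^ (89 / 47 : ℝ) := by
    rw [Real.rpow_sub two_pos, Real.rpow_one, one_div, Real.inv_rpow two_pos.le, div_eq_mul_inv]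
  refine ⟨0.296, 89 / 47, by norm_num, by norm_num, by norm_num, by norm_num, ?_, ?_⟩
  · rw [h_two]
    linarith
  · rw [h_two]
    have hc : 1 / (1 - 2 * (1 / 2 : ℝ) ^ (89 / 47 : ℝ)) ≤ 1 / (1 - 2 * 0.26914) :=
      one_div_le_one_div_of_le (by norm_num) (by linarith)
    have h_mul := mul_le_mul hc hB (by positivity) (by norm_num)
    calc _ ≤ (0.51448 : ℝ) + 1 / (1 - 2 * 0.26914) * 0.09974 + 0.26914 := add_le_add (add_le_add hA h_mul) hC
      _ ≤ 1 := by norm_num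
end

section
/- There exist real numbers λ ∈ (0, 1/2] and β ≤ 2.318 with β > 1 such that, setting c = ζ(β)/(1 − 2^{1−β}) where ζ denotes the Riemann zeta function, the inequality (1−λ)^β + c·λ^β + (ζ(β) − 1) ≤ 1 holds. (One valid choice is λ = 0.341395… and β = 2.31757….) -/
/-- The Riemann zeta function of a real argument, `ζ(β) = ∑_{i ≥ 1} i ^ (-β)`. -/
noncomputable def zetaReal (β : ℝ) : ℝ := ∑' i : ℕ, ((i : ℝ) + 1) ^ (-β)

theorem two_mul_rpow_neg_le {a t β : ℝ} (ht : 0 ≤ t) (hta : t < a) (hβ : 0 ≤ β) :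
    2 * a ^ (-β) ≤ (a - t) ^ (-β) + (a + t) ^ (-β) := by
  have ha : 0 < a := by linarith
  have hu : 0 < (a - t) ^ (-β) := Real.rpow_pos_of_pos (by linarith) _
  have hv : 0 < (a + t) ^ (-β) := Real.rpow_pos_of_pos (by linarith) _
  have h : a ^ (-β) * a ^ (-β) ≤ (a - t) ^ (-β) * (a + t) ^ (-β) := by
    rw [← Real.mul_rpow ha.le ha.le, ← Real.mul_rpow (by linarith) (by linarith)]
    exact Real.rpow_le_rpow_of_nonpos (mul_pos (by linarith) (by linarith))
      (by nlinarith) (by linarith)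
  refine le_of_pow_le_pow_left₀ two_ne_zero (by positivity) ?_
  nlinarith [sq_nonneg ((a - t) ^ (-β) - (a + t) ^ (-β))]

theorem mul_rpow_neg_le_sub_rpow {a h β : ℝ} (hh : 0 ≤ h) (hha : h < a) (hβ : 1 < β) :
    2 * h * ((β - 1) * a ^ (-β)) ≤ (a - h) ^ (1 - β) - (a + h) ^ (1 - β) := by
  let g : ℝ → ℝ := fun t ↦
    (a - t) ^ (1 - β) - (a + t) ^ (1 - β) - 2 * t * ((β - 1) * a ^ (-β))
  have hd : ∀ t ∈ Set.Icc 0 h, HasDerivAt g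
      ((β - 1) * ((a - t) ^ (-β) + (a + t) ^ (-β) - 2 * a ^ (-β))) t := by
    intro t ht
    have h1 : HasDerivAt (fun t : ℝ ↦ a - t) (-1) t := (hasDerivAt_id t).const_sub a
    have h2 : HasDerivAt (fun t : ℝ ↦ a + t) 1 t := (hasDerivAt_id t).const_add a
    have h3 := h1.rpow_const (p := 1 - β) (Or.inl (by linarith [ht.2]))
    have h4 := h2.rpow_const (p := 1 - β) (Or.inl (by linarith [ht.1]))
    have h5 := ((hasDerivAt_id t).const_mul 2).mul_const ((β - 1) * a ^ (-β))
    rw [show (1 - β - 1 : ℝ) = -β by ring] at h3 h4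
    refine ((h3.sub h4).sub h5).congr_deriv ?_
    ring
  have hm : MonotoneOn g (Set.Icc 0 h) := by
    refine monotoneOn_of_deriv_nonneg (convex_Icc 0 h)
      (fun t ht ↦ (hd t ht).continuousAt.continuousWithinAt)
      (fun t ht ↦ (hd t (interior_subset ht)).differentiableAt.differentiableWithinAt) ?_
    intro t ht
    have ht' := interior_subset ht
    rw [(hd t ht').deriv]
    have := two_mul_rpow_neg_le ht'.1 (ht'.2.trans_lt hha) (by linarith : 0 ≤ β)
    exact mul_nonneg (by linarith) (by linarith)
  have h0 := hm (Set.left_mem_Icc.2 hh) (Set.right_mem_Icc.2 hh) hh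
  simp only [g, sub_zero, add_zero, sub_self, mul_zero, zero_mul] at h0
  linarith

theorem zetaReal_le_sum_add {β : ℝ} (hβ : 1 < β) (N : ℕ) :
    zetaReal β ≤ ∑ i ∈ Finset.range N, ((i : ℝ) + 1) ^ (-β) +
      ((N : ℝ) + 1 / 2) ^ (1 - β) / (β - 1) := by
  have hβ' : 0 < β - 1 := by linarith
  have key : ∀ n : ℕ, ∑ i ∈ Finset.range (N + n), ((i : ℝ) + 1) ^ (-β) ≤
      ∑ i ∈ Finset.range N, ((i : ℝ) + 1) ^ (-β) +
        (((N : ℝ) + 1 / 2) ^ (1 - β) - (((N + n : ℕ) : ℝ) + 1 / 2) ^ (1 - β)) / (β - 1) := by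
    intro n
    induction n with
    | zero => simp
    | succ n ih =>
      rw [← add_assoc, Finset.sum_range_succ]
      have hm := mul_rpow_neg_le_sub_rpow (a := ((N + n : ℕ) : ℝ) + 1) (h := 1 / 2)
        (by norm_num) (by have : (0 : ℝ) ≤ ((N + n : ℕ) : ℝ) := Nat.cast_nonneg _
                          linarith) hβ
      rw [show ((N + n : ℕ) : ℝ) + 1 - 1 / 2 = ((N + n : ℕ) : ℝ) + 1 / 2 by ring,
        show ((N + n : ℕ) : ℝ) + 1 + 1 / 2 = ((N + n + 1 : ℕ) : ℝ) + 1 / 2 by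
          push_cast; ring] at hm
      have hd : (((N + n : ℕ) : ℝ) + 1) ^ (-β) ≤ ((((N + n : ℕ) : ℝ) + 1 / 2) ^ (1 - β) -
          (((N + n + 1 : ℕ) : ℝ) + 1 / 2) ^ (1 - β)) / (β - 1) := by
        rw [le_div_iff₀ hβ']
        linarith
      rw [sub_div] at ih hd ⊢
      linarith
  refine Real.tsum_le_of_sum_range_le (fun i ↦ by positivity) fun n ↦ ?_
  refine (Finset.sum_le_sum_of_subset_of_nonneg
    (Finset.range_mono (Nat.le_add_left n N)) fun i _ _ ↦ by positivity).trans
      ((key n).trans ?_)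
  gcongr
  exact sub_le_self _ (by positivity)

theorem rpow_neg_le_of_one_le {x r : ℝ} {p q : ℕ} (hx : 0 < x) (hr : 0 < r) (hq : q ≠ 0)
    (h : 1 ≤ r ^ q * x ^ p) : x ^ (-((p : ℝ) / q)) ≤ r := by
  refine le_of_pow_le_pow_left₀ hq hr.le ?_
  rw [← Real.rpow_natCast, ← Real.rpow_mul hx.le, neg_mul,
    div_mul_cancel₀ _ (by exact_mod_cast hq), Real.rpow_neg hx.le, Real.rpow_natCast]
  exact (inv_le_iff_one_le_mul₀ (by positivity)).2 h

set_option exponentiation.threshold 2000 in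
/-- There exist `λ ∈ (0, 1/2]` and `β ≤ 2.318` with `β > 1` such that, with
`c = ζ(β) / (1 - 2 ^ (1-β))`, the inequality
`(1-λ) ^ β + c · λ ^ β + (ζ(β) - 1) ≤ 1` holds
(one valid choice is `λ = 0.341395…`, `β = 2.31757…`). -/
theorem general_recursion_exponent :
    ∃ lam β : ℝ, 0 < lam ∧ lam ≤ 1 / 2 ∧ β ≤ 2.318 ∧ 1 < β ∧
      (1 - lam) ^ β + (zetaReal β / (1 - (2 : ℝ) ^ (1 - β))) * lam ^ β +
        (zetaReal β - 1) ≤ 1 := by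
  have hle (x r : ℝ) (hx : 0 < x) (hr : 0 < r) (h : 1 ≤ r ^ 500 * x ^ 1159) :
      x ^ (-(1159 / 500) : ℝ) ≤ r := by
    simpa using rpow_neg_le_of_one_le hx hr (by norm_num : 500 ≠ 0) h
  have h2 := hle 2 (20054530 / 100000000) (by norm_num) (by norm_num) (by norm_num)
  have h3 := hle 3 (7834891 / 100000000) (by norm_num) (by norm_num) (by norm_num)
  have h4 := hle 4 (4021842 / 100000000) (by norm_num) (by norm_num) (by norm_num)
  have h5 := hle 5 (2397660 / 100000000) (by norm_num) (by norm_num) (by norm_num)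
  have h6 := hle 6 (1571251 / 100000000) (by norm_num) (by norm_num) (by norm_num)
  have h7 := hle 7 (1099165 / 100000000) (by norm_num) (by norm_num) (by norm_num)
  have h8 := hle 8 (806562 / 100000000) (by norm_num) (by norm_num) (by norm_num)
  have h9 := hle 9 (613856 / 100000000) (by norm_num) (by norm_num) (by norm_num)
  have h10 := hle 10 (480840 / 100000000) (by norm_num) (by norm_num) (by norm_num)
  have ht := hle (21 / 2) (429421 / 100000000) (by norm_num) (by norm_num) (by norm_num)
  have hr := hle (3 / 2) (39067936 / 100000000) (by norm_num) (by norm_num) (by norm_num)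
  have hz : zetaReal (1159 / 500) ≤ 1423017 / 1000000 := by
    refine (zetaReal_le_sum_add (by norm_num) 10).trans ?_
    have hT : ((10 : ℕ) + 1 / 2 : ℝ) ^ (1 - 1159 / 500 : ℝ) =
        21 / 2 * (21 / 2 : ℝ) ^ (-(1159 / 500) : ℝ) := by
      rw [sub_eq_add_neg, Real.rpow_add (by norm_num), Real.rpow_one]
      norm_num
    rw [hT]
    norm_num [Finset.sum_range_succ] at *
    linarith
  have h2' : (2 : ℝ) ^ (1 - 1159 / 500 : ℝ) = 2 * (2 : ℝ) ^ (-(1159 / 500) : ℝ) := by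
    rw [sub_eq_add_neg, Real.rpow_add (by norm_num), Real.rpow_one]
  have hc : zetaReal (1159 / 500) / (1 - (2 : ℝ) ^ (1 - 1159 / 500 : ℝ)) ≤ 237602 / 100000 := by
    rw [h2', div_le_iff₀ (by linarith)]
    linarith
  have h3' : (1 / 3 : ℝ) ^ (1159 / 500 : ℝ) = 3 ^ (-(1159 / 500) : ℝ) := by
    rw [one_div, Real.inv_rpow (by norm_num), Real.rpow_neg (by norm_num)]
  have hr' : (1 - 1 / 3 : ℝ) ^ (1159 / 500 : ℝ) = (3 / 2) ^ (-(1159 / 500) : ℝ) := by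
    rw [show (1 - 1 / 3 : ℝ) = (3 / 2)⁻¹ by norm_num, Real.inv_rpow (by norm_num),
      Real.rpow_neg (by norm_num)]
  refine ⟨1 / 3, 1159 / 500, by norm_num, by norm_num, by norm_num, by norm_num, ?_⟩
  rw [h3', hr']
  have hm := mul_le_mul hc h3 (by positivity) (by norm_num)
  linarith
end
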